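/- arXiv:1108.6032 — 10 statements merged into one kernel-verified Lean document; each statement's English description precedes it below -/
import Mathlib

section
/- Let θ ∈ (0,1) and let ψ_θ : ℝ → ℝ be the Ali-Mikhail-Haq generator ψ_θ(t) = (1-θ)/(exp(t) - θ). Then for every d ∈ ℕ and every t > 0, (-1)^d · (iterated derivative of order d of ψ_θ at t) = ((1-θ)/θ) · ∑_{k=1}^∞ k^d · (θ·exp(-t))^k, where the series on the right converges absolutely since 0 < θ·exp(-t) < 1. -/
/-- The series `Li_{-d}(r) = ∑_{k ≥ 1} k ^ d r ^ k` converges for `|r| < 1`. -/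
lemma summable_succ_pow_mul_geometric (d : ℕ) {r : ℝ} (hr : |r| < 1) :
    Summable (fun k : ℕ => ((k : ℝ) + 1) ^ d * r ^ (k + 1)) := by
  simpa using (summable_nat_add_iff (f := fun n : ℕ => (n : ℝ) ^ d * r ^ n) 1).2
    (summable_pow_mul_geometric_of_norm_lt_one d hr)

lemma abs_mul_exp_neg_lt_one {θ t : ℝ} (hθ : |θ| < 1) (ht : 0 < t) :
    |θ * Real.exp (-t)| < 1 := by
  rw [abs_mul, Real.abs_exp]
  exact mul_lt_one_of_nonneg_of_lt_one_left (abs_nonneg θ) hθ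
    (Real.exp_le_one_iff.2 (neg_nonpos.2 ht.le))

/-- Termwise differentiation: `d/dt Li_{-d}(θ e^{-t}) = -Li_{-(d+1)}(θ e^{-t})`. -/
lemma hasDerivAt_tsum_succ_pow_mul_exp_neg (d : ℕ) {θ t : ℝ} (hθ : |θ| < 1) (ht : 0 < t) :
    HasDerivAt (fun s => ∑' k : ℕ, ((k : ℝ) + 1) ^ d * (θ * Real.exp (-s)) ^ (k + 1))
      (-∑' k : ℕ, ((k : ℝ) + 1) ^ (d + 1) * (θ * Real.exp (-t)) ^ (k + 1)) t := by
  rw [← tsum_neg]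
  refine hasDerivAt_tsum_of_isPreconnected
    (g' := fun (k : ℕ) s => -(((k : ℝ) + 1) ^ (d + 1) * (θ * Real.exp (-s)) ^ (k + 1)))
    (summable_succ_pow_mul_geometric (d + 1) ((abs_abs θ).trans_lt hθ)) isOpen_Ioi
    isPreconnected_Ioi (fun k s _ => ?_) (fun k s hs => ?_) (Set.mem_Ioi.2 ht)
    (summable_succ_pow_mul_geometric d (abs_mul_exp_neg_lt_one hθ ht)) (Set.mem_Ioi.2 ht)
  · convert! ((((hasDerivAt_neg s).exp.const_mul θ).pow (k + 1)).const_mul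
      (((k : ℝ) + 1) ^ d)) using 1
    push_cast [Nat.add_sub_cancel]
    ring
  · rw [norm_neg, norm_mul, norm_pow, norm_pow, Real.norm_eq_abs, Real.norm_eq_abs,
      abs_of_nonneg (by positivity : (0 : ℝ) ≤ (k : ℝ) + 1), abs_mul, Real.abs_exp]
    gcongr
    exact mul_le_of_le_one_right (abs_nonneg θ)
      (Real.exp_le_one_iff.2 (neg_nonpos.2 (Set.mem_Ioi.1 hs).le))

/-- Geometric expansion of the Ali-Mikhail-Haq generator. -/
lemma one_sub_div_exp_sub_eq_tsum {θ t : ℝ} (hθ : |θ| < 1) (hθ0 : θ ≠ 0) (ht : 0 < t) :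
    (1 - θ) / (Real.exp t - θ) =
      (1 - θ) / θ * ∑' k : ℕ, (θ * Real.exp (-t)) ^ (k + 1) := by
  have hlt := abs_mul_exp_neg_lt_one hθ ht
  have hne : Real.exp t - θ ≠ 0 := by
    have := Real.one_lt_exp_iff.2 ht
    have := (le_abs_self θ).trans_lt hθ
    linarith
  simp_rw [pow_succ]
  rw [tsum_mul_right, tsum_geometric_of_abs_lt_one hlt, Real.exp_neg]
  have hexp := Real.exp_ne_zero t
  have hne' : 1 - θ * (Real.exp t)⁻¹ ≠ 0 := by
    have : 1 - θ * (Real.exp t)⁻¹ = (Real.exp t - θ) / Real.exp t := by field_simp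
    rw [this]
    exact div_ne_zero hne hexp
  field_simp

lemma iteratedDeriv_one_sub_div_exp_sub (d : ℕ) {θ t : ℝ} (hθ : |θ| < 1) (hθ0 : θ ≠ 0)
    (ht : 0 < t) :
    iteratedDeriv d (fun s => (1 - θ) / (Real.exp s - θ)) t =
      (-1) ^ d * ((1 - θ) / θ *
        ∑' k : ℕ, ((k : ℝ) + 1) ^ d * (θ * Real.exp (-t)) ^ (k + 1)) := by
  induction d generalizing t with
  | zero => simpa using one_sub_div_exp_sub_eq_tsum hθ hθ0 ht
  | succ d ih =>
    rw [iteratedDeriv_succ]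
    refine (Filter.EventuallyEq.deriv_eq
      (Filter.eventuallyEq_of_mem (Ioi_mem_nhds ht) fun s hs => ih hs)).trans ?_
    rw [(((hasDerivAt_tsum_succ_pow_mul_exp_neg d hθ ht).const_mul _).const_mul _).deriv]
    ring

/-- Explicit form of the d-th derivative of the Ali-Mikhail-Haq generator
`ψ_θ(t) = (1-θ)/(exp t - θ)`: for `θ ∈ (0,1)`, `d ∈ ℕ` and `t > 0`,
`(-1)^d ψ_θ^{(d)}(t) = ((1-θ)/θ) · Li_{-d}(θ e^{-t})`, where
`Li_{-d}(z) = ∑_{k=1}^∞ k^d z^k` converges absolutely since `0 < θ e^{-t} < 1`. -/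
theorem amh_generator_deriv (θ : ℝ) (hθ : θ ∈ Set.Ioo (0 : ℝ) 1)
    (ψ : ℝ → ℝ) (hψ : ∀ t : ℝ, ψ t = (1 - θ) / (Real.exp t - θ)) :
    ∀ (d : ℕ) (t : ℝ), 0 < t →
      Summable (fun k : ℕ => ((k : ℝ) + 1) ^ d * (θ * Real.exp (-t)) ^ (k + 1)) ∧
      (-1 : ℝ) ^ d * iteratedDeriv d ψ t =
        ((1 - θ) / θ) *
          ∑' k : ℕ, ((k : ℝ) + 1) ^ d * (θ * Real.exp (-t)) ^ (k + 1) := by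
  intro d t ht
  have habs : |θ| < 1 := by rw [abs_of_pos hθ.1]; exact hθ.2
  refine ⟨summable_succ_pow_mul_geometric d (abs_mul_exp_neg_lt_one habs ht), ?_⟩
  rw [funext hψ, iteratedDeriv_one_sub_div_exp_sub d habs hθ.1.ne' ht, ← mul_assoc, ← mul_pow]
  simp
end

section
/- Let θ > 0 and let ψ_θ : ℝ → ℝ be the Frank generator ψ_θ(t) = -log(1 - (1 - exp(-θ))·exp(-t))/θ. Then for every d ∈ ℕ and every t > 0, (-1)^d · (iterated derivative of order d of ψ_θ at t) = (1/θ) · ∑_{k=1}^∞ k^{d-1} · ((1 - exp(-θ))·exp(-t))^k, where for d = 0 the exponent k^{-1} means 1/k; the series converges absolutely since 0 < (1 - exp(-θ))·exp(-t) < 1. -/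
open Real in
theorem summable_rpow_mul_pow_succ (s : ℝ) {z : ℝ} (hz0 : 0 ≤ z) (hz1 : z < 1) :
    Summable fun k : ℕ => ((k : ℝ) + 1) ^ s * z ^ (k + 1) := by
  have h : Summable fun k : ℕ => ((k + 1 : ℕ) : ℝ) ^ ⌈s⌉₊ * z ^ (k + 1) :=
    (summable_nat_add_iff (f := fun k : ℕ => (k : ℝ) ^ ⌈s⌉₊ * z ^ k) 1).2
      (summable_pow_mul_geometric_of_norm_lt_one ⌈s⌉₊
        (by rwa [norm_of_nonneg hz0]))
  refine h.of_nonneg_of_le (fun k => by positivity) fun k => ?_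
  gcongr
  rw [← rpow_natCast]
  push_cast
  exact rpow_le_rpow_of_exponent_le (by linarith [k.cast_nonneg (α := ℝ)]) (Nat.le_ceil s)

open Real in
/-- Along `z = c * exp (-t)`, differentiating the polylogarithm series in `t` raises the
exponent of `k` by one and flips the sign. -/
theorem hasDerivAt_tsum_rpow_mul_exp_neg (s : ℝ) {c t : ℝ} (hc0 : 0 ≤ c) (hc1 : c < 1)
    (ht : 0 < t) :
    HasDerivAt (fun x => ∑' k : ℕ, ((k : ℝ) + 1) ^ s * (c * exp (-x)) ^ (k + 1))
      (-∑' k : ℕ, ((k : ℝ) + 1) ^ (s + 1) * (c * exp (-t)) ^ (k + 1)) t := by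
  have hle : ∀ x : ℝ, 0 < x → c * exp (-x) ≤ c := fun x hx =>
    mul_le_of_le_one_right hc0 (exp_le_one_iff.2 (by linarith))
  rw [← tsum_neg]
  refine hasDerivAt_tsum_of_isPreconnected
    (g := fun (k : ℕ) x => ((k : ℝ) + 1) ^ s * (c * exp (-x)) ^ (k + 1))
    (g' := fun (k : ℕ) x => -(((k : ℝ) + 1) ^ (s + 1) * (c * exp (-x)) ^ (k + 1)))
    (summable_rpow_mul_pow_succ (s + 1) hc0 hc1) isOpen_Ioi isPreconnected_Ioi
    (fun k x _ => ?_) (fun k x hx => ?_) (Set.mem_Ioi.2 ht)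
    (summable_rpow_mul_pow_succ s (by positivity) ((hle t ht).trans_lt hc1)) (Set.mem_Ioi.2 ht)
  · have h : HasDerivAt (fun x => c * exp (-x)) (c * (exp (-x) * -1)) x :=
      ((hasDerivAt_neg x).exp).const_mul c
    refine ((h.pow (k + 1)).const_mul (((k : ℝ) + 1) ^ s)).congr_deriv ?_
    rw [rpow_add_one (by positivity)]
    push_cast [Nat.add_sub_cancel]
    ring
  · rw [norm_neg, norm_of_nonneg (by positivity)]
    gcongr
    exact hle x hx


/-- Explicit form of the d-th derivative of the Frank generator
`ψ_θ(t) = -log(1 - (1-e^{-θ}) e^{-t})/θ`: for `θ > 0`, `d ∈ ℕ` and `t > 0`,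
`(-1)^d ψ_θ^{(d)}(t) = (1/θ) · Li_{-(d-1)}((1-e^{-θ}) e^{-t})`, where
`Li_{-(d-1)}(z) = ∑_{k=1}^∞ k^{d-1} z^k` (for `d = 0` the exponent `k^{-1}` means `1/k`);
the series converges absolutely since `0 < (1-e^{-θ}) e^{-t} < 1`. -/
theorem frank_generator_deriv (θ : ℝ) (hθ : 0 < θ)
    (ψ : ℝ → ℝ)
    (hψ : ∀ t : ℝ, ψ t = -Real.log (1 - (1 - Real.exp (-θ)) * Real.exp (-t)) / θ) :
    ∀ (d : ℕ) (t : ℝ), 0 < t →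
      Summable (fun k : ℕ =>
        ((k : ℝ) + 1) ^ ((d : ℝ) - 1) * ((1 - Real.exp (-θ)) * Real.exp (-t)) ^ (k + 1)) ∧
      (-1 : ℝ) ^ d * iteratedDeriv d ψ t =
        (1 / θ) *
          ∑' k : ℕ, ((k : ℝ) + 1) ^ ((d : ℝ) - 1) *
            ((1 - Real.exp (-θ)) * Real.exp (-t)) ^ (k + 1) := by
  have hc0 : 0 ≤ 1 - Real.exp (-θ) := by
    linarith [Real.exp_le_one_iff.2 (neg_nonpos.2 hθ.le)]
  have hc1 : 1 - Real.exp (-θ) < 1 := by linarith [Real.exp_pos (-θ)]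
  have hz0 (t : ℝ) : 0 ≤ (1 - Real.exp (-θ)) * Real.exp (-t) := by positivity
  have hz1 (t : ℝ) (ht : 0 < t) : (1 - Real.exp (-θ)) * Real.exp (-t) < 1 :=
    (mul_le_of_le_one_right hc0 (Real.exp_le_one_iff.2 (by linarith))).trans_lt hc1
  intro d t ht
  refine ⟨summable_rpow_mul_pow_succ _ (hz0 t) (hz1 t ht), ?_⟩
  induction d generalizing t with
  | zero =>
    have hlog := (Real.hasSum_pow_div_log_of_abs_lt_one
      (abs_lt.2 ⟨by linarith [hz0 t], hz1 t ht⟩)).tsum_eq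
    rw [iteratedDeriv_zero, hψ, ← hlog]
    simp only [Nat.cast_zero, zero_sub, Real.rpow_neg_one, pow_zero, one_mul]
    simp_rw [div_eq_inv_mul, mul_one]
  | succ d ih =>
    have heq : (fun x => (-1 : ℝ) ^ d * iteratedDeriv d ψ x) =ᶠ[nhds t] _ :=
      Filter.eventually_of_mem (Ioi_mem_nhds ht) ih
    have hd := (((hasDerivAt_tsum_rpow_mul_exp_neg ((d : ℝ) - 1) hc0 hc1 ht).const_mul
      (1 / θ)).congr_of_eventuallyEq heq).deriv
    rw [deriv_const_mul_field, ← iteratedDeriv_succ] at hd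
    rw [pow_succ, mul_neg_one, neg_mul, hd]
    push_cast
    rw [mul_neg, neg_neg, sub_add_eq_add_sub]
end

section
/- Let θ ≥ 1, set α = 1/θ, and let ψ_θ : ℝ → ℝ be the Gumbel generator ψ_θ(t) = exp(-t^α). For d ∈ ℕ, d ≥ 1, and 1 ≤ k ≤ d define a^G_{dk}(θ) = (1/k!) · ∑_{j=1}^{k} (k choose j) · (-1)^{d-j} · ∏_{i=0}^{d-1} (α·j - i). Then for every t > 0, (-1)^d · (iterated derivative of order d of ψ_θ at t) = (exp(-t^α)/t^d) · ∑_{k=1}^{d} a^G_{dk}(θ) · t^{α·k}. -/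
/-- The signed coefficients of the iterated derivatives of `t ↦ exp (-t ^ α)`. -/
noncomputable def expNegRpowCoeff (α : ℝ) (d k : ℕ) : ℝ :=
  (1 / (Nat.factorial k : ℝ)) * ∑ j ∈ Finset.range (k + 1),
    (Nat.choose k j : ℝ) * (-1 : ℝ) ^ j * ∏ i ∈ Finset.range d, (α * (j : ℝ) - (i : ℝ))

theorem expNegRpowCoeff_succ_zero (α : ℝ) (d : ℕ) :
    expNegRpowCoeff α (d + 1) 0 = (α * ((0 : ℕ) : ℝ) - d) * expNegRpowCoeff α d 0 := by
  simp [expNegRpowCoeff, Finset.prod_range_succ]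
  ring

theorem expNegRpowCoeff_succ_succ (α : ℝ) (d k : ℕ) :
    expNegRpowCoeff α (d + 1) (k + 1) =
      (α * ((k + 1 : ℕ) : ℝ) - d) * expNegRpowCoeff α d (k + 1) -
        α * expNegRpowCoeff α d k := by
  have h : expNegRpowCoeff α d k = (1 / (Nat.factorial (k + 1) : ℝ)) *
      ∑ j ∈ Finset.range (k + 2), (Nat.choose (k + 1) j : ℝ) * ((k : ℝ) + 1 - j) *
        (-1 : ℝ) ^ j * ∏ i ∈ Finset.range d, (α * (j : ℝ) - (i : ℝ)) := by
    rw [Finset.sum_range_succ, expNegRpowCoeff, Finset.mul_sum, mul_add, Finset.mul_sum]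
    have hlast : (k : ℝ) + 1 - ((k + 1 : ℕ) : ℝ) = 0 := by push_cast; ring
    rw [hlast]
    simp only [mul_zero, zero_mul, add_zero]
    refine Finset.sum_congr rfl fun j hj => ?_
    have hjk : j ≤ k + 1 := (Finset.mem_range.mp hj).le
    have hc : (Nat.choose k j : ℝ) * ((k : ℝ) + 1) =
        (Nat.choose (k + 1) j : ℝ) * ((k : ℝ) + 1 - j) := by
      have := congrArg (Nat.cast (R := ℝ)) (Nat.choose_mul_succ_eq k j)
      push_cast [Nat.cast_sub hjk] at this
      exact this
    rw [← hc, Nat.factorial_succ]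
    have hk : (Nat.factorial k : ℝ) ≠ 0 := by positivity
    push_cast
    field_simp
  rw [h]
  simp only [expNegRpowCoeff, Finset.mul_sum]
  rw [← Finset.sum_sub_distrib]
  refine Finset.sum_congr rfl fun j _ => ?_
  rw [Finset.prod_range_succ]
  push_cast
  ring

theorem expNegRpowCoeff_eq_zero_of_lt (α : ℝ) {d k : ℕ} (h : d < k) :
    expNegRpowCoeff α d k = 0 := by
  induction d generalizing k with
  | zero =>
    have := Int.alternating_sum_range_choose_of_ne h.ne'
    have h' : ∑ j ∈ Finset.range (k + 1), (Nat.choose k j : ℝ) * (-1 : ℝ) ^ j = 0 := by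
      have h2 := congrArg (Int.cast (R := ℝ)) this
      push_cast at h2
      simpa only [mul_comm] using h2
    simp [expNegRpowCoeff, h']
  | succ d ih =>
    obtain ⟨k, rfl⟩ := Nat.exists_eq_succ_of_ne_zero (Nat.ne_zero_of_lt h)
    rw [Nat.succ_eq_add_one, expNegRpowCoeff_succ_succ, ih (by lia), ih (by lia)]
    ring

theorem hasDerivAt_exp_neg_rpow_mul_rpow (α β : ℝ) {t : ℝ} (ht : 0 < t) :
    HasDerivAt (fun x : ℝ => Real.exp (-(x ^ α)) * x ^ β)
      (Real.exp (-(t ^ α)) * (β * t ^ (β - 1) - α * t ^ (α + β - 1))) t := by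
  have h1 := (Real.hasDerivAt_rpow_const (p := α) (Or.inl ht.ne')).neg.exp
  have h2 := Real.hasDerivAt_rpow_const (p := β) (Or.inl ht.ne')
  refine (h1.mul h2).congr_deriv ?_
  have : t ^ (α + β - 1) = t ^ (α - 1) * t ^ β := by
    rw [← Real.rpow_add ht]; ring_nf
  simp only [Pi.neg_apply, this]
  ring

theorem iteratedDeriv_exp_neg_rpow (α : ℝ) (d : ℕ) {t : ℝ} (ht : 0 < t) :
    iteratedDeriv d (fun x : ℝ => Real.exp (-(x ^ α))) t =
      ∑ k ∈ Finset.range (d + 1),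
        expNegRpowCoeff α d k * (Real.exp (-(t ^ α)) * t ^ (α * (k : ℝ) - d)) := by
  induction d generalizing t with
  | zero => simp [expNegRpowCoeff]
  | succ d ih =>
    rw [iteratedDeriv_succ]
    have heq : iteratedDeriv d (fun x : ℝ => Real.exp (-(x ^ α))) =ᶠ[nhds t] fun x =>
        ∑ k ∈ Finset.range (d + 1),
          expNegRpowCoeff α d k * (Real.exp (-(x ^ α)) * x ^ (α * (k : ℝ) - d)) := by
      filter_upwards [lt_mem_nhds ht] with x hx using ih hx
    rw [heq.deriv_eq, (HasDerivAt.fun_sum fun (k : ℕ) _ =>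
      (hasDerivAt_exp_neg_rpow_mul_rpow α (α * (k : ℝ) - d) ht).const_mul
        (expNegRpowCoeff α d k)).deriv]
    simp only [mul_sub, Finset.sum_sub_distrib]
    have hlast : ∑ k ∈ Finset.range (d + 1), expNegRpowCoeff α d k *
          (Real.exp (-(t ^ α)) * ((α * (k : ℝ) - d) * t ^ (α * (k : ℝ) - d - 1))) =
        ∑ k ∈ Finset.range (d + 1 + 1), expNegRpowCoeff α d k *
          (Real.exp (-(t ^ α)) * ((α * (k : ℝ) - d) * t ^ (α * (k : ℝ) - d - 1))) := by
      rw [Finset.sum_range_succ _ (d + 1), expNegRpowCoeff_eq_zero_of_lt α d.lt_succ_self]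
      ring
    rw [hlast, Finset.sum_range_succ' _ (d + 1), Finset.sum_range_succ' _ (d + 1),
      add_sub_right_comm, ← Finset.sum_sub_distrib]
    congr 1
    · refine Finset.sum_congr rfl fun k _ => ?_
      rw [show α * ((k + 1 : ℕ) : ℝ) - ((d + 1 : ℕ) : ℝ) =
          α * ((k + 1 : ℕ) : ℝ) - d - 1 by push_cast; ring,
        show α + (α * (k : ℝ) - d) - 1 = α * ((k + 1 : ℕ) : ℝ) - d - 1 by push_cast; ring,
        expNegRpowCoeff_succ_succ]
      ring
    · rw [show α * ((0 : ℕ) : ℝ) - ((d + 1 : ℕ) : ℝ) =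
        α * ((0 : ℕ) : ℝ) - d - 1 by push_cast; ring, expNegRpowCoeff_succ_zero]
      ring

/-- Explicit form of the d-th derivative of the Gumbel generator
`ψ_θ(t) = exp(-t^α)` with `α = 1/θ`, `θ ≥ 1`: for `d ≥ 1` and `t > 0`,
`(-1)^d ψ_θ^{(d)}(t) = (exp(-t^α)/t^d) · ∑_{k=1}^d a^G_{dk}(θ) t^{αk}`, where
`a^G_{dk}(θ) = (1/k!) ∑_{j=1}^k (k choose j) (-1)^{d-j} ∏_{i=0}^{d-1} (αj - i)`. -/
theorem gumbel_generator_deriv (θ : ℝ) (hθ : 1 ≤ θ) (α : ℝ) (hα : α = 1 / θ)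
    (ψ : ℝ → ℝ) (hψ : ∀ t : ℝ, ψ t = Real.exp (-(t ^ α)))
    (d : ℕ) (hd : 1 ≤ d)
    (a : ℕ → ℝ)
    (ha : ∀ k : ℕ, a k = (1 / (Nat.factorial k : ℝ)) *
        ∑ j ∈ Finset.Icc 1 k, (Nat.choose k j : ℝ) * (-1 : ℝ) ^ ((d : ℤ) - (j : ℤ)) *
          ∏ i ∈ Finset.range d, (α * (j : ℝ) - (i : ℝ))) :
    ∀ t : ℝ, 0 < t →
      (-1 : ℝ) ^ d * iteratedDeriv d ψ t =
        (Real.exp (-(t ^ α)) / t ^ d) *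
          ∑ k ∈ Finset.Icc 1 d, a k * t ^ (α * (k : ℝ)) := by
  intro t ht
  obtain rfl : ψ = fun x : ℝ => Real.exp (-(x ^ α)) := funext hψ
  rw [iteratedDeriv_exp_neg_rpow α d ht, Finset.mul_sum, Finset.mul_sum,
    Finset.range_eq_Ico, Finset.sum_eq_sum_Ico_succ_bot (Nat.succ_pos d)]
  have hprod : ∏ i ∈ Finset.range d, (α * ((0 : ℕ) : ℝ) - (i : ℝ)) = 0 :=
    Finset.prod_eq_zero (Finset.mem_range.mpr hd) (by simp)
  have hzero : expNegRpowCoeff α d 0 = 0 := by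
    rw [expNegRpowCoeff, Finset.sum_range_one, hprod]
    ring
  rw [hzero, zero_mul, mul_zero, zero_add]
  refine Finset.sum_congr rfl fun k _ => ?_
  have hcoeff : (-1 : ℝ) ^ d * expNegRpowCoeff α d k = a k := by
    rw [ha, expNegRpowCoeff, Finset.range_eq_Ico,
      Finset.sum_eq_sum_Ico_succ_bot (Nat.succ_pos k), hprod, mul_zero, zero_add,
      mul_left_comm, Finset.mul_sum]
    congr 1
    refine Finset.sum_congr rfl fun j _ => ?_
    have hsign : (-1 : ℝ) ^ ((d : ℤ) - (j : ℤ)) = (-1) ^ d * (-1) ^ j := by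
      rw [zpow_sub₀ (by norm_num), zpow_natCast, zpow_natCast, div_eq_mul_inv, ← inv_pow,
        inv_neg_one]
    rw [hsign]
    ring
  rw [← hcoeff, Real.rpow_sub ht, Real.rpow_natCast]
  ring
end

section
/- Let θ ≥ 1, set α = 1/θ, and let ψ_θ : ℝ → ℝ be the Joe generator ψ_θ(t) = 1 - (1 - exp(-t))^α. For d ∈ ℕ, d ≥ 1, and 1 ≤ k ≤ d let S(d,k) = (1/k!) · ∑_{l=0}^{k} (-1)^{k-l} · (k choose l) · l^d denote the Stirling number of the second kind, and set a^J_{dk}(θ) = S(d,k) · ∏_{m=1}^{k-1} (m - α). Then for every t > 0, (-1)^d · (iterated derivative of order d of ψ_θ at t) = (exp(-t) / (θ · (1 - exp(-t))^{1-α})) · ∑_{k=1}^{d} a^J_{dk}(θ) · (exp(-t)/(1 - exp(-t)))^{k-1}. -/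
open Finset in
/-- The inclusion-exclusion formula for the Stirling numbers of the second kind. -/
theorem Nat.factorial_mul_stirlingSecond_eq_sum {R : Type*} [CommRing R] (n k : ℕ) :
    (k.factorial : R) * (n.stirlingSecond k : R) =
      ∑ l ∈ range (k + 1), (-1 : R) ^ (k - l) * (k.choose l : R) * (l : R) ^ n := by
  induction n generalizing k with
  | zero =>
    have h := add_pow (1 : R) (-1) k
    simp only [add_neg_cancel, one_pow, one_mul] at h
    simp only [pow_zero, mul_one, ← h]
    cases k <;> simp
  | succ n ih =>
    cases k with
    | zero => simp
    | succ k =>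
      have hterm : ∀ l ∈ range (k + 2),
          (-1 : R) ^ (k + 1 - l) * ((k + 1).choose l : R) * (l : R) ^ (n + 1) =
            (k + 1) * ((-1 : R) ^ (k + 1 - l) * ((k + 1).choose l : R) * (l : R) ^ n) +
            (k + 1) * (-(-1 : R) ^ (k + 1 - l) * (k.choose l : R) * (l : R) ^ n) := by
        intro l _
        have h : ((k + 1).choose l : R) * l = (k + 1) * ((k + 1).choose l - k.choose l) := by
          cases l with
          | zero => simp
          | succ l =>
            have h₁ := congrArg (Nat.cast (R := R)) (Nat.add_one_mul_choose_eq k l)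
            have h₂ := congrArg (Nat.cast (R := R)) (Nat.choose_succ_succ k l)
            push_cast at h₁ h₂ ⊢
            rw [← h₁, h₂]
            ring
        rw [pow_succ]
        linear_combination (-1 : R) ^ (k + 1 - l) * (l : R) ^ n * h
      have hlower : ∑ l ∈ range (k + 2),
          (-(-1 : R) ^ (k + 1 - l) * (k.choose l : R) * (l : R) ^ n) =
            ∑ l ∈ range (k + 1), (-1 : R) ^ (k - l) * (k.choose l : R) * (l : R) ^ n := by
        rw [sum_range_succ, Nat.choose_succ_self]
        simp only [Nat.cast_zero, mul_zero, zero_mul, add_zero]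
        refine sum_congr rfl fun l hl => ?_
        rw [Nat.succ_sub (mem_range_succ_iff.mp hl), pow_succ]
        ring
      rw [sum_congr rfl hterm, sum_add_distrib, ← mul_sum, ← mul_sum, hlower, ← ih, ← ih,
        Nat.stirlingSecond_succ_succ, Nat.factorial_succ]
      push_cast
      ring

open Finset in
/-- The operator `U j ↦ (j + 1) * U j + U (j + 1)` raises the order of a sum weighted by Stirling
numbers of the second kind. -/
theorem Nat.sum_stirlingSecond_succ {R : Type*} [CommRing R] (n : ℕ) (U : ℕ → R) :
    ∑ j ∈ range (n + 2), ((n + 2).stirlingSecond (j + 1) : R) * U j =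
      ∑ j ∈ range (n + 1),
        ((n + 1).stirlingSecond (j + 1) : R) * ((j + 1) * U j + U (j + 1)) := by
  have h₁ : ∑ j ∈ range (n + 2), ((n + 1).stirlingSecond (j + 1) : R) * ((j + 1) * U j) =
      ∑ j ∈ range (n + 1), ((n + 1).stirlingSecond (j + 1) : R) * ((j + 1) * U j) := by
    rw [sum_range_succ, Nat.stirlingSecond_eq_zero_of_lt (Nat.lt_succ_self (n + 1))]
    simp
  have h₂ : ∑ j ∈ range (n + 2), ((n + 1).stirlingSecond j : R) * U j =
      ∑ j ∈ range (n + 1), ((n + 1).stirlingSecond (j + 1) : R) * U (j + 1) := by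
    rw [sum_range_succ', Nat.stirlingSecond_succ_zero]
    simp
  simp only [mul_add, sum_add_distrib]
  rw [← h₁, ← h₂, ← sum_add_distrib]
  refine sum_congr rfl fun j _ => ?_
  rw [Nat.stirlingSecond_succ_succ (n + 1)]
  push_cast
  ring

/-- The functions whose combinations with Stirling weights are the derivatives of
`t ↦ (1 - exp (-t)) ^ α`. -/
noncomputable def joeTerm (α : ℝ) (j : ℕ) (t : ℝ) : ℝ :=
  (∏ m ∈ Finset.range j, ((m : ℝ) + 1 - α)) *
    (Real.exp (-t) ^ (j + 1) * (1 - Real.exp (-t)) ^ (α - (j + 1)))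

theorem one_sub_exp_neg_pos {t : ℝ} (ht : 0 < t) : 0 < 1 - Real.exp (-t) :=
  sub_pos.mpr (Real.exp_lt_one_iff.mpr (neg_lt_zero.mpr ht))

theorem hasDerivAt_exp_neg (t : ℝ) :
    HasDerivAt (fun s : ℝ => Real.exp (-s)) (-Real.exp (-t)) t := by
  simpa using (hasDerivAt_neg t).exp

theorem hasDerivAt_one_sub_exp_neg_rpow (p : ℝ) {t : ℝ} (ht : 0 < t) :
    HasDerivAt (fun s : ℝ => (1 - Real.exp (-s)) ^ p)
      (p * (Real.exp (-t) * (1 - Real.exp (-t)) ^ (p - 1))) t := by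
  have h := ((hasDerivAt_exp_neg t).const_sub 1).rpow_const (p := p)
    (Or.inl (one_sub_exp_neg_pos ht).ne')
  convert h using 1
  ring

theorem hasDerivAt_joeTerm (α : ℝ) (j : ℕ) {t : ℝ} (ht : 0 < t) :
    HasDerivAt (joeTerm α j) (-((j + 1) * joeTerm α j t + joeTerm α (j + 1) t)) t := by
  have h := (((hasDerivAt_exp_neg t).pow (j + 1)).mul
    (hasDerivAt_one_sub_exp_neg_rpow (α - (j + 1)) ht)).const_mul
      (∏ m ∈ Finset.range j, ((m : ℝ) + 1 - α))
  refine h.congr_deriv ?_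
  simp only [joeTerm, Finset.prod_range_succ, Nat.add_sub_cancel, Pi.pow_apply]
  rw [show α - (((j + 1 : ℕ) : ℝ) + 1) = α - (j + 1) - 1 by push_cast; ring]
  push_cast
  ring

open Finset in
theorem iteratedDeriv_one_sub_one_sub_exp_neg_rpow (α : ℝ) (n : ℕ) {t : ℝ} (ht : 0 < t) :
    iteratedDeriv (n + 1) (fun s : ℝ => 1 - (1 - Real.exp (-s)) ^ α) t =
      (-1) ^ (n + 1) *
        (α * ∑ j ∈ range (n + 1), ((n + 1).stirlingSecond (j + 1) : ℝ) * joeTerm α j t) := by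
  induction n generalizing t with
  | zero =>
    rw [iteratedDeriv_one, ((hasDerivAt_one_sub_exp_neg_rpow α ht).const_sub 1).deriv]
    simp [joeTerm, Nat.stirlingSecond_one_right]
  | succ n ih =>
    rw [iteratedDeriv_succ]
    have heq := (eventually_gt_nhds ht).mono fun s hs => ih hs
    rw [Filter.EventuallyEq.deriv_eq heq]
    have hsum := HasDerivAt.fun_sum (u := range (n + 1)) fun j _ =>
      (hasDerivAt_joeTerm α j ht).const_mul ((n + 1).stirlingSecond (j + 1) : ℝ)
    rw [((hsum.const_mul α).const_mul _).deriv, Nat.sum_stirlingSecond_succ]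
    simp only [mul_neg, sum_neg_distrib]
    ring

theorem joeTerm_eq (α : ℝ) (j : ℕ) {t : ℝ} (ht : 0 < t) :
    joeTerm α j t = Real.exp (-t) / (1 - Real.exp (-t)) ^ (1 - α) *
      ((∏ m ∈ Finset.range j, ((m : ℝ) + 1 - α)) *
        (Real.exp (-t) / (1 - Real.exp (-t))) ^ j) := by
  have hy := one_sub_exp_neg_pos ht
  rw [joeTerm, show α - ((j : ℝ) + 1) = -(1 - α) - j by ring, Real.rpow_sub hy,
    Real.rpow_neg hy.le, Real.rpow_natCast, div_pow]
  ring

/-- Explicit form of the d-th derivative of the Joe generator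
`ψ_θ(t) = 1 - (1 - e^{-t})^α` with `α = 1/θ`, `θ ≥ 1`: for `d ≥ 1` and `t > 0`,
`(-1)^d ψ_θ^{(d)}(t)
  = (e^{-t}/(θ (1-e^{-t})^{1-α})) · ∑_{k=1}^d a^J_{dk}(θ) (e^{-t}/(1-e^{-t}))^{k-1}`,
where `a^J_{dk}(θ) = S(d,k) ∏_{m=1}^{k-1} (m - α)` and
`S(d,k) = (1/k!) ∑_{l=0}^k (-1)^{k-l} (k choose l) l^d` is the Stirling number
of the second kind. -/
theorem joe_generator_deriv (θ : ℝ) (hθ : 1 ≤ θ) (α : ℝ) (hα : α = 1 / θ)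
    (ψ : ℝ → ℝ) (hψ : ∀ t : ℝ, ψ t = 1 - (1 - Real.exp (-t)) ^ α)
    (d : ℕ) (hd : 1 ≤ d)
    (S : ℕ → ℕ → ℝ)
    (hS : ∀ d' k : ℕ, S d' k = (1 / (Nat.factorial k : ℝ)) *
        ∑ l ∈ Finset.range (k + 1),
          (-1 : ℝ) ^ (k - l) * (Nat.choose k l : ℝ) * (l : ℝ) ^ d')
    (a : ℕ → ℝ)
    (ha : ∀ k : ℕ, a k = S d k * ∏ m ∈ Finset.Icc 1 (k - 1), ((m : ℝ) - α)) :
    ∀ t : ℝ, 0 < t →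
      (-1 : ℝ) ^ d * iteratedDeriv d ψ t =
        (Real.exp (-t) / (θ * (1 - Real.exp (-t)) ^ (1 - α))) *
          ∑ k ∈ Finset.Icc 1 d,
            a k * (Real.exp (-t) / (1 - Real.exp (-t))) ^ (k - 1) := by
  intro t ht
  obtain ⟨n, rfl⟩ := Nat.exists_eq_add_of_le' hd
  obtain rfl : ψ = fun s => 1 - (1 - Real.exp (-s)) ^ α := funext hψ
  rw [iteratedDeriv_one_sub_one_sub_exp_neg_rpow α n ht, ← mul_assoc, ← mul_pow,
    neg_one_mul, neg_neg, one_pow, one_mul, Finset.mul_sum, Finset.mul_sum,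
    ← Finset.Ico_add_one_right_eq_Icc, Finset.sum_Ico_eq_sum_range, Nat.add_sub_cancel]
  refine Finset.sum_congr rfl fun j _ => ?_
  have hprod : ∏ m ∈ Finset.Icc 1 j, ((m : ℝ) - α) =
      ∏ m ∈ Finset.range j, ((m : ℝ) + 1 - α) := by
    rw [← Finset.Ico_add_one_right_eq_Icc, Finset.prod_Ico_eq_prod_range, Nat.add_sub_cancel]
    exact Finset.prod_congr rfl fun m _ => by push_cast; ring
  have hk : ((j + 1).factorial : ℝ) ≠ 0 := Nat.cast_ne_zero.mpr (Nat.factorial_ne_zero _)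
  rw [add_comm 1 j, ha, hS, ← Nat.factorial_mul_stirlingSecond_eq_sum,
    one_div, inv_mul_cancel_left₀ hk, Nat.add_sub_cancel, hprod, joeTerm_eq α j ht, hα]
  ring
end

section
/- Let θ ∈ (0,1), d ∈ ℕ with d ≥ 2, and u = (u_1,…,u_d) ∈ (0,1)^d. Let ψ_θ(t) = (1-θ)/(exp(t)-θ) be the Ali-Mikhail-Haq generator with inverse ψ_θ^{-1}(u) = log((1 - θ·(1-u))/u), and set t_θ(u) = ∑_{j=1}^d ψ_θ^{-1}(u_j) and h^A_θ(u) = θ · ∏_{j=1}^d u_j/(1 - θ·(1-u_j)). Then 0 < h^A_θ(u) < 1 and (-1)^d · ψ_θ^{(d)}(t_θ(u)) · ∏_{j=1}^d (-(ψ_θ^{-1})'(u_j)) = ((1-θ)^{d+1}/θ^2) · (h^A_θ(u) / ∏_{j=1}^d u_j^2) · ∑_{k=1}^∞ k^d · h^A_θ(u)^k. -/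
/-- The shifted polylogarithm series `∑ (k + 1) ^ n * x ^ (k + 1)` converges for `x ∈ [0, 1)`. -/
theorem summable_succ_pow_mul_pow_succ (n : ℕ) {x : ℝ} (hx0 : 0 ≤ x) (hx1 : x < 1) :
    Summable fun k : ℕ => ((k : ℝ) + 1) ^ n * x ^ (k + 1) := by
  have h := summable_pow_mul_geometric_of_norm_lt_one (R := ℝ) n (r := x)
    (by rwa [Real.norm_of_nonneg hx0])
  simpa using (summable_nat_add_iff 1).2 h

/-- Differentiating `∑ (k + 1) ^ n * (θ * exp (-t)) ^ (k + 1)` in `t` raises the exponent `n`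
by one and changes the sign. -/
theorem hasDerivAt_tsum_succ_pow_mul_exp (n : ℕ) {θ : ℝ} (hθ : θ ∈ Set.Ioo (0 : ℝ) 1)
    {t : ℝ} (ht : 0 < t) :
    HasDerivAt (fun s : ℝ => ∑' k : ℕ, ((k : ℝ) + 1) ^ n * (θ * Real.exp (-s)) ^ (k + 1))
      (-∑' k : ℕ, ((k : ℝ) + 1) ^ (n + 1) * (θ * Real.exp (-t)) ^ (k + 1)) t := by
  have hlt : ∀ s : ℝ, 0 < s → θ * Real.exp (-s) ≤ θ := fun s hs =>
    mul_le_of_le_one_right hθ.1.le (Real.exp_le_one_iff.2 (by linarith))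
  have hnn : ∀ s : ℝ, 0 ≤ θ * Real.exp (-s) := fun s => mul_nonneg hθ.1.le (Real.exp_nonneg _)
  rw [← tsum_neg]
  refine hasDerivAt_tsum_of_isPreconnected
    (g := fun (k : ℕ) (s : ℝ) => ((k : ℝ) + 1) ^ n * (θ * Real.exp (-s)) ^ (k + 1))
    (g' := fun (k : ℕ) (s : ℝ) => -(((k : ℝ) + 1) ^ (n + 1) * (θ * Real.exp (-s)) ^ (k + 1)))
    (summable_succ_pow_mul_pow_succ (n + 1) hθ.1.le hθ.2) isOpen_Ioi
    isPreconnected_Ioi (fun k s _ => ?_) (fun k s hs => ?_) (Set.mem_Ioi.2 ht)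
    (summable_succ_pow_mul_pow_succ n (hnn t) ((hlt t ht).trans_lt hθ.2)) (Set.mem_Ioi.2 ht)
  · have h := ((((hasDerivAt_id s).neg.exp).const_mul θ).pow (k + 1)).const_mul (((k : ℝ) + 1) ^ n)
    refine h.congr_deriv ?_
    simp only [id, Pi.neg_apply, Nat.add_sub_cancel]
    push_cast
    ring
  · have := hnn s
    rw [norm_neg, Real.norm_of_nonneg (by positivity)]
    have := hlt s hs
    gcongr

/-- The derivatives of the Ali-Mikhail-Haq generator as polylogarithm series. -/
theorem iteratedDeriv_amh_generator {θ : ℝ} (hθ : θ ∈ Set.Ioo (0 : ℝ) 1) (n : ℕ)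
    {t : ℝ} (ht : 0 < t) :
    iteratedDeriv n (fun s : ℝ => (1 - θ) / (Real.exp s - θ)) t =
      (-1) ^ n * ((1 - θ) / θ) *
        ∑' k : ℕ, ((k : ℝ) + 1) ^ n * (θ * Real.exp (-t)) ^ (k + 1) := by
  induction n generalizing t with
  | zero =>
    have h0 : 0 ≤ θ * Real.exp (-t) := mul_nonneg hθ.1.le (Real.exp_nonneg _)
    have h1 : θ * Real.exp (-t) < 1 := (mul_le_of_le_one_right hθ.1.le
      (Real.exp_le_one_iff.2 (by linarith))).trans_lt hθ.2
    have hexp : 1 < Real.exp t := Real.one_lt_exp_iff.2 ht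
    have hθ0 : θ ≠ 0 := hθ.1.ne'
    have hne : Real.exp t - θ ≠ 0 := by linarith [hθ.2]
    simp only [iteratedDeriv_zero, pow_zero, one_mul, pow_succ, tsum_mul_right]
    rw [tsum_geometric_of_lt_one h0 h1]
    have hgeom : 1 - θ * (Real.exp t)⁻¹ = (Real.exp t - θ) / Real.exp t := by
      have := Real.exp_ne_zero t
      field_simp
    rw [Real.exp_neg, hgeom]
    field_simp
  | succ n ih =>
    have hev : iteratedDeriv n (fun s : ℝ => (1 - θ) / (Real.exp s - θ)) =ᶠ[nhds t]
        fun s => (-1) ^ n * ((1 - θ) / θ) *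
          ∑' k : ℕ, ((k : ℝ) + 1) ^ n * (θ * Real.exp (-s)) ^ (k + 1) := by
      filter_upwards [Ioi_mem_nhds ht] with s hs using ih hs
    rw [iteratedDeriv_succ, hev.deriv_eq,
      ((hasDerivAt_tsum_succ_pow_mul_exp n hθ ht).const_mul _).deriv]
    ring

/-- The derivative of the inverse of the Ali-Mikhail-Haq generator. -/
theorem hasDerivAt_amh_generator_inv {θ v : ℝ} (hv : v ≠ 0) (hw : 1 - θ * (1 - v) ≠ 0) :
    HasDerivAt (fun v : ℝ => Real.log ((1 - θ * (1 - v)) / v))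
      (-((1 - θ) / (v * (1 - θ * (1 - v))))) v := by
  have h1 : HasDerivAt (fun v : ℝ => 1 - θ * (1 - v)) θ v := by
    simpa using (((hasDerivAt_id v).const_sub 1).const_mul θ).const_sub 1
  refine ((h1.div (hasDerivAt_id v) hv).log (div_ne_zero hw hv)).congr_deriv ?_
  simp only [id, Pi.div_apply]
  field_simp
  ring

/-- Closed form of the d-dimensional Ali-Mikhail-Haq copula density: with
`ψ_θ(t) = (1-θ)/(e^t - θ)`, `ψ_θ^{-1}(u) = log((1-θ(1-u))/u)`,
`t_θ(u) = ∑_j ψ_θ^{-1}(u_j)` and `h^A_θ(u) = θ ∏_j u_j/(1-θ(1-u_j))`, one has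
`0 < h^A_θ(u) < 1` and
`(-1)^d ψ_θ^{(d)}(t_θ(u)) ∏_j (-(ψ_θ^{-1})'(u_j))
   = ((1-θ)^{d+1}/θ^2) (h^A_θ(u)/∏_j u_j^2) Li_{-d}(h^A_θ(u))`. -/
theorem amh_copula_density (θ : ℝ) (hθ : θ ∈ Set.Ioo (0 : ℝ) 1)
    (d : ℕ) (hd : 2 ≤ d) (u : Fin d → ℝ) (hu : ∀ j, u j ∈ Set.Ioo (0 : ℝ) 1)
    (ψ ψinv : ℝ → ℝ)
    (hψ : ∀ t : ℝ, ψ t = (1 - θ) / (Real.exp t - θ))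
    (hψinv : ∀ v : ℝ, ψinv v = Real.log ((1 - θ * (1 - v)) / v))
    (t h : ℝ)
    (ht : t = ∑ j, ψinv (u j))
    (hh : h = θ * ∏ j, u j / (1 - θ * (1 - u j))) :
    (0 < h ∧ h < 1) ∧
    (-1 : ℝ) ^ d * iteratedDeriv d ψ t * ∏ j, (-(deriv ψinv (u j))) =
      ((1 - θ) ^ (d + 1) / θ ^ 2) * (h / ∏ j, (u j) ^ 2) *
        ∑' k : ℕ, ((k : ℝ) + 1) ^ d * h ^ (k + 1) := by
  obtain rfl : ψ = fun s => (1 - θ) / (Real.exp s - θ) := funext hψ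
  obtain rfl : ψinv = fun v => Real.log ((1 - θ * (1 - v)) / v) := funext hψinv
  have hθ0 := hθ.1
  have hθ1 := hθ.2
  have hu0 : ∀ j, 0 < u j := fun j => (hu j).1
  have hlt : ∀ j, u j < 1 - θ * (1 - u j) := fun j => by
    nlinarith [mul_pos (sub_pos.2 hθ1) (sub_pos.2 (hu j).2)]
  have hw : ∀ j, 0 < 1 - θ * (1 - u j) := fun j => (hu0 j).trans (hlt j)
  have ht0 : 0 < t := by
    rw [ht]
    refine Finset.sum_pos (fun j _ => Real.log_pos ((one_lt_div (hu0 j)).2 (hlt j)))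
      ⟨⟨0, by omega⟩, Finset.mem_univ _⟩
  have hexp : θ * Real.exp (-t) = h := by
    rw [hh, ht, ← Finset.sum_neg_distrib, Real.exp_sum]
    congr 1
    refine Finset.prod_congr rfl fun j _ => ?_
    rw [Real.exp_neg, Real.exp_log (div_pos (hw j) (hu0 j)), inv_div]
  have hpos : 0 < h := hexp ▸ mul_pos hθ0 (Real.exp_pos _)
  have hlt1 : h < 1 := hexp ▸ (mul_le_of_le_one_right hθ0.le
    (Real.exp_le_one_iff.2 (by linarith))).trans_lt hθ1
  refine ⟨⟨hpos, hlt1⟩, ?_⟩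
  have hprod : ∏ j, (-(deriv (fun v => Real.log ((1 - θ * (1 - v)) / v)) (u j))) =
      (1 - θ) ^ d * (h / θ / ∏ j, (u j) ^ 2) := by
    rw [hh, mul_div_cancel_left₀ _ hθ0.ne', ← Finset.prod_div_distrib]
    have hconst : (1 - θ) ^ d = ∏ _j : Fin d, (1 - θ) := by simp
    rw [hconst, ← Finset.prod_mul_distrib]
    refine Finset.prod_congr rfl fun j _ => ?_
    rw [(hasDerivAt_amh_generator_inv (hu0 j).ne' (hw j).ne').deriv]
    have h1 := (hu0 j).ne'
    have h2 := (hw j).ne'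
    field_simp
  have hsign : (-1 : ℝ) ^ d * (-1) ^ d = 1 := by rw [← mul_pow]; norm_num
  rw [hprod, iteratedDeriv_amh_generator hθ d ht0, hexp, mul_assoc ((-1) ^ d) ((1 - θ) / θ),
    ← mul_assoc ((-1) ^ d) ((-1) ^ d), hsign]
  ring
end

section
/- Let θ > 0, d ∈ ℕ with d ≥ 2, and u = (u_1,…,u_d) ∈ (0,1)^d. Let ψ_θ(t) = -log(1 - (1-exp(-θ))·exp(-t))/θ be the Frank generator with inverse ψ_θ^{-1}(u) = -log((1 - exp(-θ·u))/(1 - exp(-θ))), set t_θ(u) = ∑_{j=1}^d ψ_θ^{-1}(u_j) and h^F_θ(u) = (1 - exp(-θ))^{1-d} · ∏_{j=1}^d (1 - exp(-θ·u_j)). Then 0 < h^F_θ(u) < 1 and (-1)^d · ψ_θ^{(d)}(t_θ(u)) · ∏_{j=1}^d (-(ψ_θ^{-1})'(u_j)) = (θ/(1-exp(-θ)))^{d-1} · (∑_{k=1}^∞ k^{d-1} · h^F_θ(u)^k) · exp(-θ·∑_{j=1}^d u_j) / h^F_θ(u). -/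
/-- Termwise differentiation of the series `∑ (k+1)^n z^(k+1) = Li_{-n}(z)` inside the unit disc. -/
theorem hasDerivAt_tsum_succ_pow_mul_pow (n : ℕ) {z : ℝ} (hz : |z| < 1) :
    HasDerivAt (fun y : ℝ => ∑' k : ℕ, ((k : ℝ) + 1) ^ n * y ^ (k + 1))
      (∑' k : ℕ, ((k : ℝ) + 1) ^ (n + 1) * z ^ k) z := by
  obtain ⟨r, hzr, hr1⟩ := exists_between hz
  have hr0 : 0 < r := (abs_nonneg z).trans_lt hzr
  have hsum : Summable fun k : ℕ => ((k : ℝ) + 1) ^ (n + 1) * r ^ k := by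
    have h1 := (summable_nat_add_iff 1).2
      (summable_pow_mul_geometric_of_norm_lt_one (R := ℝ) (n + 1)
        (by rwa [Real.norm_eq_abs, abs_of_pos hr0]))
    refine (h1.mul_right r⁻¹).congr fun k => ?_
    push_cast
    field_simp
    ring
  refine hasDerivAt_tsum_of_isPreconnected hsum Metric.isOpen_ball
    (convex_ball (0 : ℝ) r).isPreconnected
    (g := fun (k : ℕ) (y : ℝ) => ((k : ℝ) + 1) ^ n * y ^ (k + 1))
    (g' := fun (k : ℕ) (y : ℝ) => ((k : ℝ) + 1) ^ (n + 1) * y ^ k)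
    (fun k y _ => ?_) (fun k y hy => ?_) (Metric.mem_ball_self hr0) ?_ (by simpa using hzr)
  · refine ((hasDerivAt_pow (k + 1) y).const_mul (((k : ℝ) + 1) ^ n)).congr_deriv ?_
    push_cast
    ring
  · have hy' : |y| ≤ r := by simpa using (mem_ball_zero_iff.1 hy).le
    rw [norm_mul, norm_pow, norm_pow, Real.norm_eq_abs, Real.norm_eq_abs,
      abs_of_pos (by positivity : (0 : ℝ) < (k : ℝ) + 1)]
    gcongr
  · simp [summable_zero]

open Filter Topology in
/-- Derivatives of `t ↦ -log (1 - p e^{-t}) / θ` as negative-order polylogarithms. -/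
theorem iteratedDeriv_succ_neg_log_one_sub_mul_exp_neg (θ : ℝ) {p : ℝ} (hp : 0 < p) (n : ℕ)
    {t : ℝ} (ht : p * Real.exp (-t) < 1) :
    iteratedDeriv (n + 1) (fun s => -Real.log (1 - p * Real.exp (-s)) / θ) t =
      (-1) ^ (n + 1) / θ * ∑' k : ℕ, ((k : ℝ) + 1) ^ n * (p * Real.exp (-t)) ^ (k + 1) := by
  have hexp (s : ℝ) : HasDerivAt (fun s => p * Real.exp (-s)) (-(p * Real.exp (-s))) s := by
    refine ((hasDerivAt_neg s).exp.const_mul p).congr_deriv ?_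
    ring
  induction n generalizing t with
  | zero =>
    have hz : 0 < p * Real.exp (-t) := by positivity
    rw [zero_add, iteratedDeriv_one]
    have h1 := ((((hexp t).const_sub 1).log (by linarith)).neg.div_const θ).deriv
    refine h1.trans ?_
    simp only [pow_zero, one_mul, pow_succ, tsum_mul_right, tsum_geometric_of_lt_one hz.le ht]
    ring
  | succ n ih =>
    have hz : 0 < p * Real.exp (-t) := by positivity
    have hev : ∀ᶠ s in 𝓝 t, p * Real.exp (-s) < 1 :=
      (hexp t).continuousAt.eventually_lt continuousAt_const ht
    rw [iteratedDeriv_succ, EventuallyEq.deriv_eq (hev.mono fun s hs => ih hs)]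
    have h1 := ((hasDerivAt_tsum_succ_pow_mul_pow n (by rwa [abs_of_pos hz])).comp t
      (hexp t)).const_mul ((-1) ^ (n + 1) / θ)
    refine h1.deriv.trans ?_
    simp only [pow_succ (p * Real.exp (-t)), ← mul_assoc, tsum_mul_right]
    ring

/-- The derivative of the inverse Frank generator. -/
theorem hasDerivAt_neg_log_one_sub_exp_div {θ v p : ℝ} (hθ : 0 < θ) (hv : 0 < v) (hp : 0 < p) :
    HasDerivAt (fun v => -Real.log ((1 - Real.exp (-(θ * v))) / p))
      (-(θ * Real.exp (-(θ * v)) / (1 - Real.exp (-(θ * v))))) v := by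
  have hq : 0 < 1 - Real.exp (-(θ * v)) := by
    simpa using mul_pos hθ hv
  have h1 : HasDerivAt (fun v : ℝ => θ * v) θ v := by
    simpa using (hasDerivAt_id v).const_mul θ
  refine ((((h1.fun_neg.exp.const_sub 1).div_const p).log (by positivity)).neg).congr_deriv ?_
  field_simp

/-- Closed form of the d-dimensional Frank copula density: with
`ψ_θ(t) = -log(1-(1-e^{-θ})e^{-t})/θ`, `ψ_θ^{-1}(u) = -log((1-e^{-θu})/(1-e^{-θ}))`,
`t_θ(u) = ∑_j ψ_θ^{-1}(u_j)` and `h^F_θ(u) = (1-e^{-θ})^{1-d} ∏_j (1-e^{-θu_j})`,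
one has `0 < h^F_θ(u) < 1` and
`(-1)^d ψ_θ^{(d)}(t_θ(u)) ∏_j (-(ψ_θ^{-1})'(u_j))
   = (θ/(1-e^{-θ}))^{d-1} Li_{-(d-1)}(h^F_θ(u)) exp(-θ ∑_j u_j)/h^F_θ(u)`. -/
theorem frank_copula_density (θ : ℝ) (hθ : 0 < θ)
    (d : ℕ) (hd : 2 ≤ d) (u : Fin d → ℝ) (hu : ∀ j, u j ∈ Set.Ioo (0 : ℝ) 1)
    (ψ ψinv : ℝ → ℝ)
    (hψ : ∀ t : ℝ, ψ t = -Real.log (1 - (1 - Real.exp (-θ)) * Real.exp (-t)) / θ)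
    (hψinv : ∀ v : ℝ,
      ψinv v = -Real.log ((1 - Real.exp (-(θ * v))) / (1 - Real.exp (-θ))))
    (t h : ℝ)
    (ht : t = ∑ j, ψinv (u j))
    (hh : h = (1 - Real.exp (-θ)) ^ ((1 : ℝ) - (d : ℝ)) *
        ∏ j, (1 - Real.exp (-(θ * u j)))) :
    (0 < h ∧ h < 1) ∧
    (-1 : ℝ) ^ d * iteratedDeriv d ψ t * ∏ j, (-(deriv ψinv (u j))) =
      (θ / (1 - Real.exp (-θ))) ^ (d - 1) *
        (∑' k : ℕ, ((k : ℝ) + 1) ^ (d - 1) * h ^ (k + 1)) *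
        Real.exp (-(θ * ∑ j, u j)) / h := by
  set p := 1 - Real.exp (-θ) with hp_def
  have hp : 0 < p := by simpa [hp_def] using hθ
  have hp1 : p < 1 := by simp [hp_def, Real.exp_pos]
  have hq (j : Fin d) : 0 < 1 - Real.exp (-(θ * u j)) := by
    simpa using mul_pos hθ (hu j).1
  have hqp (j : Fin d) : 1 - Real.exp (-(θ * u j)) < p := by
    have : θ * u j < θ := mul_lt_of_lt_one_right hθ (hu j).2
    simpa [hp_def] using this
  have hpow : p ^ ((1 : ℝ) - (d : ℝ)) = p / p ^ d := by
    rw [Real.rpow_sub hp, Real.rpow_one, Real.rpow_natCast]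
  have hexp : p * Real.exp (-t) = h := by
    have : Real.exp (-t) = ∏ j, ((1 - Real.exp (-(θ * u j))) / p) := by
      rw [ht, ← Finset.sum_neg_distrib, Real.exp_sum]
      refine Finset.prod_congr rfl fun j _ => ?_
      rw [hψinv, neg_neg, Real.exp_log (div_pos (hq j) hp)]
    rw [this, hh, hpow, Finset.prod_div_distrib]
    simp only [Finset.prod_const, Finset.card_univ, Fintype.card_fin]
    ring
  have hpos : 0 < h := hexp ▸ mul_pos hp (Real.exp_pos _)
  have hlt : h < 1 := by
    have ht0 : 0 ≤ t := by
      rw [ht]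
      refine Finset.sum_nonneg fun j _ => ?_
      rw [hψinv, neg_nonneg]
      exact Real.log_nonpos (div_pos (hq j) hp).le ((div_le_one hp).2 (hqp j).le)
    rw [← hexp]
    exact (mul_le_of_le_one_right hp.le (Real.exp_le_one_iff.2 (by linarith))).trans_lt hp1
  refine ⟨⟨hpos, hlt⟩, ?_⟩
  obtain ⟨n, rfl⟩ : ∃ n, d = n + 1 := ⟨d - 1, by omega⟩
  have hdprod : ∏ j, (-(deriv ψinv (u j))) =
      θ ^ (n + 1) * Real.exp (-(θ * ∑ j, u j)) / ∏ j, (1 - Real.exp (-(θ * u j))) := by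
    rw [Finset.mul_sum, ← Finset.sum_neg_distrib, Real.exp_sum]
    simp only [funext hψinv, (hasDerivAt_neg_log_one_sub_exp_div hθ (hu _).1 hp).deriv, neg_neg,
      Finset.prod_div_distrib, Finset.prod_mul_distrib, Finset.prod_const, Finset.card_univ,
      Fintype.card_fin]
  have hQ : ∏ j, (1 - Real.exp (-(θ * u j))) = h * p ^ n := by
    rw [hh, hpow]
    field_simp
    ring
  rw [hdprod, hQ, funext hψ,
    iteratedDeriv_succ_neg_log_one_sub_mul_exp_neg θ hp n (hexp.trans_lt hlt), hexp,
    Nat.add_sub_cancel, div_pow]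
  have hsign : ((-1 : ℝ) ^ (n + 1)) * (-1) ^ (n + 1) = 1 := by
    rw [← mul_pow]; norm_num
  generalize (∑' k : ℕ, ((k : ℝ) + 1) ^ n * h ^ (k + 1)) = S
  generalize Real.exp (-(θ * ∑ j, u j)) = E
  rw [← mul_assoc, mul_div_assoc' _ _ θ, hsign]
  field_simp
  ring
end

section
/- Let β > 0, let ψ : ℝ → ℝ be infinitely differentiable on (0,∞), and define ψ̃(t) = ψ(t^{1/β}) for t > 0. For d ∈ ℕ, d ≥ 1, and 1 ≤ k ≤ d let a^G_{dk}(β) = (1/k!)·∑_{j=1}^{k} (k choose j)·(-1)^{d-j}·∏_{i=0}^{d-1}(j/β - i). Then for every t > 0, (-1)^d · (iterated derivative of order d of ψ̃ at t) = (1/t^d) · ∑_{k=1}^{d} a^G_{dk}(β) · (-1)^k · (iterated derivative of order k of ψ at t^{1/β}) · t^{k/β}. -/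
open Finset in
/-- The unnormalized coefficient `∑ⱼ (k choose j) (-1)^(k+j) ∏_{i<d} (j c - i)` in the `d`-th
derivative of `t ↦ ψ (t ^ c)`. -/
noncomputable def powerDerivCoeff (c : ℝ) (d k : ℕ) : ℝ :=
  ∑ j ∈ range (k + 1), (k.choose j : ℝ) * (-1) ^ (k + j) * ∏ i ∈ range d, ((j : ℝ) * c - i)

lemma powerDerivCoeff_zero_zero (c : ℝ) : powerDerivCoeff c 0 0 = 1 := by
  simp [powerDerivCoeff]

lemma powerDerivCoeff_zero_succ (c : ℝ) (k : ℕ) : powerDerivCoeff c 0 (k + 1) = 0 := by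
  have h := Int.alternating_sum_range_choose_of_ne (n := k + 1) (by omega)
  have h' : ∑ j ∈ Finset.range (k + 1 + 1), (-1 : ℝ) ^ j * ((k + 1).choose j : ℝ) = 0 := by
    exact_mod_cast h
  rw [powerDerivCoeff, ← mul_zero ((-1 : ℝ) ^ (k + 1)), ← h', Finset.mul_sum]
  refine Finset.sum_congr rfl fun j _ => ?_
  rw [Finset.prod_range_zero]
  ring

lemma powerDerivCoeff_succ_zero (c : ℝ) (d : ℕ) : powerDerivCoeff c (d + 1) 0 = 0 := by
  simp [powerDerivCoeff, Finset.prod_range_succ']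

lemma powerDerivCoeff_succ_succ (c : ℝ) (d k : ℕ) :
    powerDerivCoeff c (d + 1) (k + 1) =
      (((k + 1 : ℕ) : ℝ) * c - d) * powerDerivCoeff c d (k + 1) +
        ((k : ℝ) + 1) * c * powerDerivCoeff c d k := by
  have hk : ((k : ℝ) + 1) * c * powerDerivCoeff c d k =
      ∑ j ∈ Finset.range (k + 1 + 1), ((k : ℝ) + 1) * c *
        ((k.choose j : ℝ) * (-1) ^ (k + j) * ∏ i ∈ Finset.range d, ((j : ℝ) * c - i)) := by
    rw [Finset.sum_range_succ _ (k + 1), powerDerivCoeff, Finset.mul_sum]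
    simp
  rw [hk, powerDerivCoeff, powerDerivCoeff, Finset.mul_sum, ← Finset.sum_add_distrib]
  refine Finset.sum_congr rfl fun j hj => ?_
  have hj' : j ≤ k + 1 := by simpa [Nat.lt_succ_iff] using hj
  have hc : ((k : ℝ) + 1) * (k.choose j : ℝ) = ((k + 1).choose j : ℝ) * ((k : ℝ) + 1 - j) := by
    have h := Nat.choose_mul_succ_eq k j
    rw [← Nat.cast_inj (R := ℝ)] at h
    push_cast [Nat.cast_sub hj'] at h
    linarith
  rw [Finset.prod_range_succ]
  push_cast
  linear_combination (-c * (-1) ^ (k + j) * ∏ i ∈ Finset.range d, ((j : ℝ) * c - i)) * hc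

lemma powerDerivCoeff_eq_zero_of_lt (c : ℝ) {d k : ℕ} (h : d < k) :
    powerDerivCoeff c d k = 0 := by
  induction d generalizing k with
  | zero =>
    obtain ⟨k, rfl⟩ := Nat.exists_eq_succ_of_ne_zero h.ne'
    exact powerDerivCoeff_zero_succ c k
  | succ d ih =>
    obtain ⟨k, rfl⟩ := Nat.exists_eq_succ_of_ne_zero (Nat.ne_zero_of_lt h)
    rw [Nat.succ_eq_add_one, powerDerivCoeff_succ_succ, ih (by omega), ih (by omega)]
    ring

lemma hasDerivAt_rpow_mul_iteratedDeriv_comp_rpow {ψ : ℝ → ℝ}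
    (hψ : ContDiffOn ℝ (⊤ : ℕ∞) ψ (Set.Ioi (0 : ℝ))) (c p : ℝ) (k : ℕ) {t : ℝ} (ht : 0 < t) :
    HasDerivAt (fun s : ℝ => s ^ p * iteratedDeriv k ψ (s ^ c))
      (p * t ^ (p - 1) * iteratedDeriv k ψ (t ^ c) +
        c * t ^ (p + c - 1) * iteratedDeriv (k + 1) ψ (t ^ c)) t := by
  have hy : 0 < t ^ c := Real.rpow_pos_of_pos ht c
  have hd : DifferentiableAt ℝ (iteratedDeriv k ψ) (t ^ c) := by
    rw [iteratedDeriv_eq_equiv_comp, LinearIsometryEquiv.comp_differentiableAt_iff]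
    exact (hψ.contDiffAt (Ioi_mem_nhds hy)).differentiableAt_iteratedFDeriv
      (by exact_mod_cast ENat.natCast_lt_top k)
  have h := (Real.hasDerivAt_rpow_const (p := p) (Or.inl ht.ne')).mul
    (hd.hasDerivAt.comp t (Real.hasDerivAt_rpow_const (p := c) (Or.inl ht.ne')))
  refine h.congr_deriv ?_
  rw [iteratedDeriv_succ, show p + c - 1 = p + (c - 1) by ring, Real.rpow_add ht]
  simp only [Function.comp_apply]
  ring

theorem iteratedDeriv_comp_rpow {ψ : ℝ → ℝ}
    (hψ : ContDiffOn ℝ (⊤ : ℕ∞) ψ (Set.Ioi (0 : ℝ))) (c : ℝ) (d : ℕ) {t : ℝ} (ht : 0 < t) :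
    iteratedDeriv d (fun s => ψ (s ^ c)) t =
      ∑ k ∈ Finset.range (d + 1), powerDerivCoeff c d k / (k.factorial : ℝ) *
        (t ^ ((k : ℝ) * c - d) * iteratedDeriv k ψ (t ^ c)) := by
  induction d generalizing t with
  | zero => simp [powerDerivCoeff_zero_zero]
  | succ d ih =>
    have hsum := HasDerivAt.fun_sum (u := Finset.range (d + 1)) fun k _ =>
      (hasDerivAt_rpow_mul_iteratedDeriv_comp_rpow hψ c ((k : ℝ) * c - d) k ht).const_mul
        (powerDerivCoeff c d k / (k.factorial : ℝ))
    have heq : iteratedDeriv d (fun s => ψ (s ^ c)) =ᶠ[nhds t] _ :=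
      Filter.eventually_of_mem (Ioi_mem_nhds ht) fun s hs => ih hs
    rw [iteratedDeriv_succ, heq.deriv_eq, hsum.deriv]
    simp only [mul_add, Finset.sum_add_distrib]
    have hext : ∀ f : ℕ → ℝ, ∑ k ∈ Finset.range (d + 1), powerDerivCoeff c d k / (k.factorial : ℝ) *
        f k = ∑ k ∈ Finset.range (d + 1), powerDerivCoeff c d (k + 1) / ((k + 1).factorial : ℝ) *
          f (k + 1) + powerDerivCoeff c d 0 * f 0 := fun f => by
      have h := Finset.sum_range_succ (fun k => powerDerivCoeff c d k / (k.factorial : ℝ) * f k)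
        (d + 1)
      rw [powerDerivCoeff_eq_zero_of_lt c (Nat.lt_succ_self d), zero_div, zero_mul, add_zero] at h
      rw [← h, Finset.sum_range_succ']
      simp
    have hzero : (d : ℝ) * powerDerivCoeff c d 0 = 0 := by
      cases d with
      | zero => simp
      | succ d => rw [powerDerivCoeff_succ_zero, mul_zero]
    rw [hext, Finset.sum_range_succ' _ (d + 1), powerDerivCoeff_succ_zero, add_right_comm,
      ← Finset.sum_add_distrib]
    congr 1
    · refine Finset.sum_congr rfl fun k _ => ?_
      have hk : ((k.factorial : ℕ) : ℝ) ≠ 0 := by exact_mod_cast k.factorial_ne_zero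
      have hk1 : (k : ℝ) + 1 ≠ 0 := by positivity
      rw [powerDerivCoeff_succ_succ, Nat.factorial_succ]
      push_cast
      rw [show (k : ℝ) * c - d + c - 1 = ((k : ℝ) + 1) * c - (d + 1) by ring,
        show ((k : ℝ) + 1) * c - d - 1 = ((k : ℝ) + 1) * c - (d + 1) by ring]
      field_simp
    · push_cast
      linear_combination (-t ^ ((0 : ℝ) * c - d - 1) * iteratedDeriv 0 ψ (t ^ c)) * hzero


/-- Schlömilch-type formula for derivatives of the outer power transformation:
for `β > 0`, `ψ` smooth on `(0,∞)` and `ψ̃(t) = ψ(t^{1/β})`, with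
`a^G_{dk}(β) = (1/k!) ∑_{j=1}^k (k choose j)(-1)^{d-j} ∏_{i=0}^{d-1}(j/β - i)`,
one has, for `d ≥ 1` and `t > 0`,
`(-1)^d ψ̃^{(d)}(t) = (1/t^d) ∑_{k=1}^d a^G_{dk}(β) (-1)^k ψ^{(k)}(t^{1/β}) t^{k/β}`. -/
theorem outer_power_deriv (β : ℝ) (hβ : 0 < β)
    (ψ : ℝ → ℝ) (hψ : ContDiffOn ℝ (⊤ : ℕ∞) ψ (Set.Ioi (0 : ℝ)))
    (ψt : ℝ → ℝ) (hψt : ∀ t : ℝ, ψt t = ψ (t ^ (1 / β)))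
    (d : ℕ) (hd : 1 ≤ d)
    (a : ℕ → ℝ)
    (ha : ∀ k : ℕ, a k = (1 / (Nat.factorial k : ℝ)) *
        ∑ j ∈ Finset.Icc 1 k, (Nat.choose k j : ℝ) * (-1 : ℝ) ^ ((d : ℤ) - (j : ℤ)) *
          ∏ i ∈ Finset.range d, ((j : ℝ) / β - (i : ℝ))) :
    ∀ t : ℝ, 0 < t →
      (-1 : ℝ) ^ d * iteratedDeriv d ψt t =
        (1 / t ^ d) * ∑ k ∈ Finset.Icc 1 d,
          a k * ((-1 : ℝ) ^ k * iteratedDeriv k ψ (t ^ (1 / β))) * t ^ ((k : ℝ) / β) := by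
  intro t ht
  obtain rfl : ψt = fun s => ψ (s ^ (1 / β)) := funext hψt
  have hd0 : powerDerivCoeff (1 / β) d 0 = 0 := by
    obtain ⟨d, rfl⟩ := Nat.exists_eq_succ_of_ne_zero (Nat.ne_zero_of_lt hd)
    exact powerDerivCoeff_succ_zero _ d
  have hprod : ∏ i ∈ Finset.range d, (-(i : ℝ)) = 0 :=
    Finset.prod_eq_zero (Finset.mem_range.2 hd) (by simp)
  have hIcc : ∀ (n : ℕ) (f : ℕ → ℝ), f 0 = 0 →
      ∑ k ∈ Finset.range (n + 1), f k = ∑ k ∈ Finset.Icc 1 n, f k := fun n f hf => by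
    rw [Finset.range_eq_Ico, Finset.sum_eq_sum_Ico_succ_bot (Nat.succ_pos n), hf, zero_add]
    rfl
  have hcoeff : ∀ k, a k * (-1) ^ k =
      (-1) ^ d * (powerDerivCoeff (1 / β) d k / (k.factorial : ℝ)) := fun k => by
    rw [ha, powerDerivCoeff, hIcc _ _ (by simp [hprod]), one_div_mul_eq_div, div_mul_eq_mul_div,
      mul_div_assoc', Finset.sum_mul, Finset.mul_sum]
    congr 1
    refine Finset.sum_congr rfl fun j _ => ?_
    have hs : (-1 : ℝ) ^ ((d : ℤ) - (j : ℤ)) = (-1) ^ d * (-1) ^ j := by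
      rw [zpow_sub₀ (by norm_num), zpow_natCast, zpow_natCast, div_eq_mul_inv, ← inv_pow]
      norm_num
    simp only [hs, mul_one_div, pow_add]
    ring
  rw [iteratedDeriv_comp_rpow hψ _ _ ht, hIcc _ _ (by rw [hd0, zero_div, zero_mul]), Finset.mul_sum, Finset.mul_sum]
  refine Finset.sum_congr rfl fun k _ => ?_
  rw [← mul_assoc (a k), hcoeff, mul_one_div, Real.rpow_sub ht, Real.rpow_natCast]
  ring
end

section
/- For ν ∈ ℝ and t > 0 let K_ν(t) = ∫_0^∞ cosh(ν·x)·exp(-t·cosh(x)) dx denote the modified Bessel function of the third kind. Let ν ∈ ℝ and θ > 0, and define the GIG density f(x) = (2x)^{ν-1}/(θ^ν·K_ν(θ)) · exp(-(θ^2/(2x) + 2x)/2) for x > 0. Then for every t ≥ 0, ∫_0^∞ exp(-t·x)·f(x) dx = (1+t)^{-ν/2} · K_ν(θ·√(1+t)) / K_ν(θ); in particular (taking t = 0) f integrates to 1. -/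
open MeasureTheory Set

/-- The two-sided integrand of the modified Bessel function is integrable. -/
lemma integrable_exp_mul_exp_neg_mul_cosh (ν : ℝ) {z : ℝ} (hz : 0 < z) :
    Integrable fun u : ℝ ↦ Real.exp (ν * u) * Real.exp (-z * Real.cosh u) := by
  have h := (integrable_exp_neg_mul_sq (b := z / 4) (by positivity)).const_mul
    (Real.exp (ν ^ 2 / z))
  refine h.mono' (by fun_prop) (Filter.Eventually.of_forall fun u ↦ ?_)
  rw [Real.norm_of_nonneg (by positivity), ← Real.exp_add, ← Real.exp_add, Real.exp_le_exp]
  have hc : u ^ 2 / 2 ≤ Real.cosh u := by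
    rw [← Real.cosh_abs, ← sq_abs]
    have h3 : Real.cosh |u| = 2 * Real.sinh (|u| / 2) ^ 2 + 1 := by
      have h := Real.cosh_two_mul (|u| / 2)
      rw [mul_div_cancel₀ _ two_ne_zero, Real.cosh_sq] at h
      linarith
    have h4 := Real.self_le_sinh_iff.2 (by positivity : 0 ≤ |u| / 2)
    have h5 : (|u| / 2) ^ 2 ≤ Real.sinh (|u| / 2) ^ 2 := by gcongr
    nlinarith
  have h1 : z * (u ^ 2 / 2) ≤ z * Real.cosh u := by gcongr
  have h2 : 0 ≤ (z * u / 2 - ν) ^ 2 / z := by positivity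
  have h3 : (z * u / 2 - ν) ^ 2 / z = z / 4 * u ^ 2 - ν * u + ν ^ 2 / z := by
    field_simp
    ring
  linarith

/-- The two-sided integral representation of the modified Bessel function. -/
lemma integral_exp_mul_exp_neg_mul_cosh (ν : ℝ) {z : ℝ} (hz : 0 < z) :
    ∫ u : ℝ, Real.exp (ν * u) * Real.exp (-z * Real.cosh u) =
      2 * ∫ u in Ioi (0 : ℝ), Real.cosh (ν * u) * Real.exp (-z * Real.cosh u) := by
  have hp := integrable_exp_mul_exp_neg_mul_cosh ν hz
  have hn := integrable_exp_mul_exp_neg_mul_cosh (-ν) hz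
  have hneg := integral_comp_neg_Ioi (0 : ℝ)
    fun u ↦ Real.exp (ν * u) * Real.exp (-z * Real.cosh u)
  rw [neg_zero] at hneg
  rw [← intervalIntegral.integral_Iic_add_Ioi (b := 0) hp.integrableOn hp.integrableOn, ← hneg,
    ← integral_const_mul, ← integral_add ?_ hp.integrableOn]
  · refine integral_congr_ae (Filter.Eventually.of_forall fun u ↦ ?_)
    simp only [Real.cosh_neg, Real.cosh_eq (ν * u), mul_neg]
    ring
  · refine hn.integrableOn.congr (Filter.Eventually.of_forall fun u ↦ ?_)
    simp

/-- The modified Bessel function is positive. -/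
lemma integral_cosh_mul_exp_neg_mul_cosh_pos (ν : ℝ) {z : ℝ} (hz : 0 < z) :
    0 < ∫ u in Ioi (0 : ℝ), Real.cosh (ν * u) * Real.exp (-z * Real.cosh u) := by
  have h : 0 < ∫ u : ℝ, Real.exp (ν * u) * Real.exp (-z * Real.cosh u) := by
    refine integral_pos_of_integrable_nonneg_nonzero (x := 0) (by fun_prop)
      (integrable_exp_mul_exp_neg_mul_cosh ν hz) (fun u ↦ ?_) (by positivity)
    simp only [Pi.zero_apply]
    positivity
  rw [integral_exp_mul_exp_neg_mul_cosh ν hz] at h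
  linarith

/-- Substituting `x = c * exp u` in an integral over the positive half-line. -/
lemma integral_Ioi_eq_integral_mul_exp (g : ℝ → ℝ) {c : ℝ} (hc : 0 < c) :
    ∫ x in Ioi (0 : ℝ), g x = ∫ u : ℝ, c * Real.exp u * g (c * Real.exp u) := by
  have himage : (fun u : ℝ ↦ c * Real.exp u) '' univ = Ioi 0 := by
    rw [image_univ]
    ext y
    refine ⟨?_, fun hy ↦ ⟨Real.log (y / c), ?_⟩⟩
    · rintro ⟨u, rfl⟩
      exact mul_pos hc (Real.exp_pos u)
    · simp only [Real.exp_log (div_pos hy hc)]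
      field_simp
  have hinj : InjOn (fun u : ℝ ↦ c * Real.exp u) univ := fun u _ v _ h ↦
    Real.exp_injective (mul_left_cancel₀ hc.ne' h)
  rw [← himage, integral_image_eq_integral_abs_deriv_smul MeasurableSet.univ
    (fun u _ ↦ ((Real.hasDerivAt_exp u).const_mul c).hasDerivWithinAt) hinj, setIntegral_univ]
  refine integral_congr_ae (Filter.Eventually.of_forall fun u ↦ ?_)
  simp only [smul_eq_mul, abs_of_pos (mul_pos hc (Real.exp_pos u))]

/-- The unnormalised generalized inverse Gaussian integral. -/
lemma integral_rpow_mul_exp_neg_gig (ν : ℝ) {θ s : ℝ} (hθ : 0 < θ) (hs : 0 < s) :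
    ∫ x in Ioi (0 : ℝ), (2 * x) ^ (ν - 1) *
        Real.exp (-(θ ^ 2 / (2 * x) + s ^ 2 * (2 * x)) / 2) =
      (θ / s) ^ ν * ∫ u in Ioi (0 : ℝ), Real.cosh (ν * u) * Real.exp (-(θ * s) * Real.cosh u) := by
  rw [integral_Ioi_eq_integral_mul_exp _ (c := θ / s / 2) (by positivity)]
  have h := integral_exp_mul_exp_neg_mul_cosh ν (mul_pos hθ hs)
  rw [← mul_right_inj' (two_ne_zero (α := ℝ)), mul_left_comm, ← h, ← integral_const_mul,
    ← integral_const_mul]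
  refine integral_congr_ae (Filter.Eventually.of_forall fun u ↦ ?_)
  have hy : 2 * (θ / s / 2 * Real.exp u) = θ / s * Real.exp u := by ring
  have hexp : -(θ ^ 2 / (θ / s * Real.exp u) + s ^ 2 * (θ / s * Real.exp u)) / 2 =
      -(θ * s) * Real.cosh u := by
    rw [Real.cosh_eq, Real.exp_neg]
    field_simp
    ring
  have hpow : θ / s * Real.exp u * (θ / s * Real.exp u) ^ (ν - 1) =
      (θ / s) ^ ν * Real.exp (ν * u) := by
    rw [Real.rpow_sub_one (by positivity), mul_div_cancel₀ _ (by positivity),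
      Real.mul_rpow (by positivity) (by positivity), ← Real.exp_mul, mul_comm u]
  simp only [hy, hexp]
  rw [← mul_assoc ((θ / s) ^ ν), ← hpow]
  ring


/-- Laplace transform of the GIG density: with
`K_ν(t) = ∫_0^∞ cosh(νx) e^{-t cosh x} dx` and
`f(x) = (2x)^{ν-1}/(θ^ν K_ν(θ)) exp(-(θ²/(2x) + 2x)/2)` for `x > 0`, one has,
for all `t ≥ 0`,
`∫_0^∞ e^{-tx} f(x) dx = (1+t)^{-ν/2} K_ν(θ√(1+t))/K_ν(θ)`;
in particular (taking `t = 0`) `f` integrates to one. -/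
theorem gig_laplace_transform
    (K : ℝ → ℝ → ℝ)
    (hK : ∀ ν t : ℝ, K ν t =
      ∫ x in Set.Ioi (0 : ℝ), Real.cosh (ν * x) * Real.exp (-t * Real.cosh x))
    (ν θ : ℝ) (hθ : 0 < θ)
    (f : ℝ → ℝ)
    (hf : ∀ x : ℝ, f x = (2 * x) ^ (ν - 1) / (θ ^ ν * K ν θ) *
        Real.exp (-(θ ^ 2 / (2 * x) + 2 * x) / 2)) :
    (∀ t : ℝ, 0 ≤ t →
      ∫ x in Set.Ioi (0 : ℝ), Real.exp (-t * x) * f x =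
        (1 + t) ^ (-ν / 2) * K ν (θ * Real.sqrt (1 + t)) / K ν θ) ∧
    ∫ x in Set.Ioi (0 : ℝ), f x = 1 := by
  have key : ∀ t : ℝ, 0 ≤ t →
      ∫ x in Ioi (0 : ℝ), Real.exp (-t * x) * f x =
        (1 + t) ^ (-ν / 2) * K ν (θ * Real.sqrt (1 + t)) / K ν θ := by
    intro t ht
    have hs : 0 < Real.sqrt (1 + t) := Real.sqrt_pos.2 (by positivity)
    have hsq : Real.sqrt (1 + t) ^ 2 = 1 + t := Real.sq_sqrt (by positivity)
    have hpow : (θ / Real.sqrt (1 + t)) ^ ν = θ ^ ν * (1 + t) ^ (-ν / 2) := by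
      rw [Real.div_rpow hθ.le hs.le, Real.sqrt_eq_rpow, ← Real.rpow_mul (by positivity),
        div_eq_mul_inv, ← Real.rpow_neg (by positivity)]
      ring_nf
    have h := integral_rpow_mul_exp_neg_gig ν hθ hs
    rw [← hK, hpow, hsq] at h
    calc ∫ x in Ioi (0 : ℝ), Real.exp (-t * x) * f x
        = ∫ x in Ioi (0 : ℝ), (θ ^ ν * K ν θ)⁻¹ * ((2 * x) ^ (ν - 1) *
            Real.exp (-(θ ^ 2 / (2 * x) + (1 + t) * (2 * x)) / 2)) := by
          refine integral_congr_ae (Filter.Eventually.of_forall fun x ↦ ?_)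
          have hexp : -(θ ^ 2 / (2 * x) + (1 + t) * (2 * x)) / 2 =
              -t * x + -(θ ^ 2 / (2 * x) + 2 * x) / 2 := by ring
          simp only [hf, hexp, Real.exp_add]
          ring
      _ = (1 + t) ^ (-ν / 2) * K ν (θ * Real.sqrt (1 + t)) / K ν θ := by
          rw [integral_const_mul, h]
          have : θ ^ ν ≠ 0 := (Real.rpow_pos_of_pos hθ ν).ne'
          field_simp
  refine ⟨key, ?_⟩
  have hpos : K ν θ ≠ 0 := by
    rw [hK]
    exact (integral_cosh_mul_exp_neg_mul_cosh_pos ν hθ).ne'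
  simpa [hpos] using key 0 le_rfl
end

section
/- For ν ∈ ℝ and t > 0 let K_ν(t) = ∫_0^∞ cosh(ν·x)·exp(-t·cosh(x)) dx. Let ν ∈ ℝ, θ > 0, and let ψ : ℝ → ℝ be the GIG generator ψ(t) = (1+t)^{-ν/2}·K_ν(θ·√(1+t))/K_ν(θ). Then for every d ∈ ℕ and every t > 0, (-1)^d · (iterated derivative of order d of ψ at t) = (θ/2)^d · (1+t)^{-(ν+d)/2} · K_{ν+d}(θ·√(1+t)) / K_ν(θ). -/
open MeasureTheory Set Filter Topology Asymptotics

/-- The modified Bessel function of the third kind, in its integral representation. -/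
noncomputable def besselK (ν t : ℝ) : ℝ :=
  ∫ x in Ioi (0 : ℝ), Real.cosh (ν * x) * Real.exp (-t * Real.cosh x)

lemma sq_div_four_le_cosh {x : ℝ} (hx : 0 ≤ x) : x ^ 2 / 4 ≤ Real.cosh x := by
  have h := Real.quadratic_le_exp_of_nonneg hx
  have h' := Real.exp_pos (-x)
  rw [Real.cosh_eq]
  linarith

lemma mul_exp_neg_mul_cosh_isBigO {F : ℝ → ℝ} {c t : ℝ} (ht : 0 < t)
    (hF : ∀ x, 0 ≤ x → |F x| ≤ Real.exp (c * x)) :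
    (fun x => F x * Real.exp (-t * Real.cosh x)) =O[atTop] fun x => Real.exp (-1 * x) := by
  refine IsBigO.of_bound (Real.exp ((c + 1) ^ 2 / t)) ?_
  filter_upwards [eventually_ge_atTop 0] with x hx
  rw [norm_mul, Real.norm_eq_abs, Real.norm_eq_abs, Real.norm_eq_abs, Real.abs_exp, Real.abs_exp]
  refine (mul_le_mul_of_nonneg_right (hF x hx) (Real.exp_pos _).le).trans ?_
  rw [← Real.exp_add, ← Real.exp_add, Real.exp_le_exp]
  have hcosh := mul_le_mul_of_nonneg_left (sq_div_four_le_cosh hx) ht.le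
  have hsq : (c + 1) ^ 2 / t - (c + 1) * x + t * (x ^ 2 / 4)
      = ((c + 1) - t * x / 2) ^ 2 / t := by
    field_simp
    ring
  have hnonneg : 0 ≤ ((c + 1) - t * x / 2) ^ 2 / t := by positivity
  linarith

lemma integrableOn_mul_exp_neg_mul_cosh {F : ℝ → ℝ} {c t : ℝ} (ht : 0 < t)
    (hc : Continuous F) (hF : ∀ x, 0 ≤ x → |F x| ≤ Real.exp (c * x)) :
    IntegrableOn (fun x => F x * Real.exp (-t * Real.cosh x)) (Ioi 0) :=
  integrable_of_isBigO_exp_neg one_pos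
    (hc.mul (Real.continuous_exp.comp (continuous_const.mul Real.continuous_cosh))).continuousOn
    (mul_exp_neg_mul_cosh_isBigO ht hF)

lemma tendsto_mul_exp_neg_mul_cosh {F : ℝ → ℝ} {c t : ℝ} (ht : 0 < t)
    (hF : ∀ x, 0 ≤ x → |F x| ≤ Real.exp (c * x)) :
    Tendsto (fun x => F x * Real.exp (-t * Real.cosh x)) atTop (𝓝 0) := by
  refine (mul_exp_neg_mul_cosh_isBigO ht hF).trans_tendsto ?_
  simpa using Real.tendsto_exp_neg_atTop_nhds_zero

lemma abs_cosh_mul_le (ν : ℝ) {x : ℝ} (hx : 0 ≤ x) :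
    |Real.cosh (ν * x)| ≤ Real.exp (|ν| * x) := by
  rw [abs_of_pos (Real.cosh_pos _), ← Real.cosh_abs, abs_mul, abs_of_nonneg hx, Real.cosh_eq]
  have h : Real.exp (-(|ν| * x)) ≤ Real.exp (|ν| * x) :=
    Real.exp_le_exp.2 (by linarith [mul_nonneg (abs_nonneg ν) hx])
  linarith

lemma abs_sinh_mul_le (ν : ℝ) {x : ℝ} (hx : 0 ≤ x) :
    |Real.sinh (ν * x)| ≤ Real.exp (|ν| * x) := by
  refine le_trans ?_ (abs_cosh_mul_le ν hx)
  rw [abs_of_pos (Real.cosh_pos _), Real.abs_sinh, ← Real.cosh_abs (ν * x)]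
  exact (Real.sinh_lt_cosh _).le

lemma abs_cosh_mul_mul_cosh_le (ν : ℝ) {x : ℝ} (hx : 0 ≤ x) :
    |Real.cosh (ν * x) * Real.cosh x| ≤ Real.exp ((|ν| + 1) * x) := by
  rw [abs_mul, add_mul, Real.exp_add]
  have h := abs_cosh_mul_le 1 hx
  simp only [one_mul, abs_one] at h ⊢
  exact mul_le_mul (abs_cosh_mul_le ν hx) h (abs_nonneg _) (Real.exp_pos _).le

lemma abs_sinh_mul_mul_sinh_le (ν : ℝ) {x : ℝ} (hx : 0 ≤ x) :
    |Real.sinh (ν * x) * Real.sinh x| ≤ Real.exp ((|ν| + 1) * x) := by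
  rw [abs_mul, add_mul, Real.exp_add]
  have h := abs_sinh_mul_le 1 hx
  simp only [one_mul, abs_one] at h ⊢
  exact mul_le_mul (abs_sinh_mul_le ν hx) h (abs_nonneg _) (Real.exp_pos _).le

lemma integrableOn_besselK_integrand (ν : ℝ) {t : ℝ} (ht : 0 < t) :
    IntegrableOn (fun x => Real.cosh (ν * x) * Real.exp (-t * Real.cosh x)) (Ioi 0) :=
  integrableOn_mul_exp_neg_mul_cosh ht (by fun_prop) fun _ hx => abs_cosh_mul_le ν hx

lemma integrableOn_cosh_mul_cosh (ν : ℝ) {t : ℝ} (ht : 0 < t) :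
    IntegrableOn (fun x => Real.cosh (ν * x) * Real.cosh x * Real.exp (-t * Real.cosh x))
      (Ioi 0) :=
  integrableOn_mul_exp_neg_mul_cosh ht (by fun_prop) fun _ hx => abs_cosh_mul_mul_cosh_le ν hx

lemma integrableOn_sinh_mul_sinh (ν : ℝ) {t : ℝ} (ht : 0 < t) :
    IntegrableOn (fun x => Real.sinh (ν * x) * Real.sinh x * Real.exp (-t * Real.cosh x))
      (Ioi 0) :=
  integrableOn_mul_exp_neg_mul_cosh ht (by fun_prop) fun _ hx => abs_sinh_mul_mul_sinh_le ν hx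

lemma mul_besselK_eq_integral (ν : ℝ) {t : ℝ} (ht : 0 < t) :
    ν * besselK ν t =
      t * ∫ x in Ioi (0 : ℝ),
        Real.sinh (ν * x) * Real.sinh x * Real.exp (-t * Real.cosh x) := by
  have hI := (integrableOn_besselK_integrand ν ht).const_mul ν
  have hJ := (integrableOn_sinh_mul_sinh ν ht).const_mul t
  have h := integral_Ioi_of_hasDerivAt_of_tendsto' (a := 0)
    (f := fun x => Real.sinh (ν * x) * Real.exp (-t * Real.cosh x))
    (fun x _ => by
      have h1 := (((hasDerivAt_id x).const_mul ν).sinh).mul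
        (((Real.hasDerivAt_cosh x).const_mul (-t)).exp)
      refine h1.congr_deriv (g' := ν * (Real.cosh (ν * x) * Real.exp (-t * Real.cosh x)) -
        t * (Real.sinh (ν * x) * Real.sinh x * Real.exp (-t * Real.cosh x))) ?_
      simp only [id]
      ring)
    (hI.sub hJ) (tendsto_mul_exp_neg_mul_cosh ht fun _ hx => abs_sinh_mul_le ν hx)
  rw [integral_sub' hI hJ, integral_const_mul, integral_const_mul] at h
  simp only [mul_zero, Real.sinh_zero, zero_mul, sub_zero] at h
  exact sub_eq_zero.1 h

lemma besselK_add_one (ν : ℝ) {t : ℝ} (ht : 0 < t) :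
    besselK (ν + 1) t =
      (∫ x in Ioi (0 : ℝ), Real.cosh (ν * x) * Real.cosh x * Real.exp (-t * Real.cosh x)) +
        ν / t * besselK ν t := by
  rw [div_mul_eq_mul_div, mul_besselK_eq_integral ν ht, mul_div_cancel_left₀ _ ht.ne',
    ← integral_add (integrableOn_cosh_mul_cosh ν ht) (integrableOn_sinh_mul_sinh ν ht), besselK]
  refine integral_congr_ae (Eventually.of_forall fun x => ?_)
  simp only [add_mul, one_mul, Real.cosh_add]

lemma hasDerivAt_besselK (ν : ℝ) {t : ℝ} (ht : 0 < t) :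
    HasDerivAt (besselK ν) (ν / t * besselK ν t - besselK (ν + 1) t) t := by
  have h := (hasDerivAt_integral_of_dominated_loc_of_deriv_le
    (μ := volume.restrict (Ioi (0 : ℝ))) (x₀ := t) (s := Ioi (t / 2))
    (F := fun s x => Real.cosh (ν * x) * Real.exp (-s * Real.cosh x))
    (F' := fun s x => -(Real.cosh (ν * x) * Real.cosh x * Real.exp (-s * Real.cosh x)))
    (bound := fun x => Real.cosh (ν * x) * Real.cosh x * Real.exp (-(t / 2) * Real.cosh x))
    (Ioi_mem_nhds (half_lt_self ht))
    (Eventually.of_forall fun s => by fun_prop)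
    (integrableOn_besselK_integrand ν ht) (by fun_prop)
    (Eventually.of_forall fun x s hs => ?_)
    (integrableOn_cosh_mul_cosh ν (half_pos ht))
    (Eventually.of_forall fun x s _ => ?_)).2
  · rw [integral_neg] at h
    refine h.congr_deriv ?_
    rw [besselK_add_one ν ht]
    ring
  · have hx := Real.cosh_pos x
    have hνx := Real.cosh_pos (ν * x)
    rw [norm_neg, Real.norm_of_nonneg (by positivity)]
    gcongr
    exact (mem_Ioi.1 hs).le
  · refine ((((hasDerivAt_id s).neg.mul_const (Real.cosh x)).exp).const_mul
      (Real.cosh (ν * x))).congr_deriv ?_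
    simp only [Pi.neg_apply, id]
    ring

lemma hasDerivAt_rpow_mul_besselK (μ : ℝ) {θ t : ℝ} (hθ : 0 < θ) (ht : 0 < 1 + t) :
    HasDerivAt (fun s => (1 + s) ^ (-(μ / 2)) * besselK μ (θ * Real.sqrt (1 + s)))
      (-(θ / 2 * ((1 + t) ^ (-((μ + 1) / 2)) * besselK (μ + 1) (θ * Real.sqrt (1 + t))))) t := by
  have hr : 0 < Real.sqrt (1 + t) := Real.sqrt_pos.2 ht
  have h1 : HasDerivAt (fun s : ℝ => 1 + s) 1 t := (hasDerivAt_id t).const_add 1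
  have h := (h1.rpow_const (p := -(μ / 2)) (Or.inl ht.ne')).mul
    ((hasDerivAt_besselK μ (mul_pos hθ hr)).comp t ((h1.sqrt ht.ne').const_mul θ))
  refine h.congr_deriv ?_
  have e1 : (1 + t) ^ (-(μ / 2) - 1) = (1 + t) ^ (-(μ / 2)) / Real.sqrt (1 + t) ^ 2 := by
    rw [Real.rpow_sub_one ht.ne', Real.sq_sqrt ht.le]
  have e2 : (1 + t) ^ (-((μ + 1) / 2)) = (1 + t) ^ (-(μ / 2)) / Real.sqrt (1 + t) := by
    rw [Real.sqrt_eq_rpow, ← Real.rpow_sub ht]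
    congr 1
    ring
  rw [e1, e2]
  simp only [Function.comp_apply]
  field_simp
  ring

lemma iteratedDeriv_rpow_mul_besselK (ν : ℝ) {θ : ℝ} (hθ : 0 < θ) (C : ℝ) (d : ℕ) {t : ℝ}
    (ht : 0 < 1 + t) :
    iteratedDeriv d
        (fun s => (1 + s) ^ (-(ν / 2)) * besselK ν (θ * Real.sqrt (1 + s)) / C) t =
      (-(θ / 2)) ^ d *
        ((1 + t) ^ (-((ν + d) / 2)) * besselK (ν + d) (θ * Real.sqrt (1 + t))) / C := by
  induction d generalizing t with
  | zero => simp
  | succ d ih =>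
    have hnear : ∀ᶠ s in 𝓝 t, 0 < 1 + s :=
      (continuous_const.add continuous_id).continuousAt.eventually_const_lt ht
    rw [iteratedDeriv_succ, EventuallyEq.deriv_eq (hnear.mono fun s hs => ih hs),
      (((hasDerivAt_rpow_mul_besselK (ν + d) hθ ht).const_mul _).div_const C).deriv]
    push_cast
    rw [← add_assoc, pow_succ]
    ring

/-- Derivatives of the GIG generator: with
`K_ν(t) = ∫_0^∞ cosh(νx) e^{-t cosh x} dx` and
`ψ(t) = (1+t)^{-ν/2} K_ν(θ√(1+t))/K_ν(θ)`, one has, for every `d ∈ ℕ` and `t > 0`,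
`(-1)^d ψ^{(d)}(t) = (θ/2)^d (1+t)^{-(ν+d)/2} K_{ν+d}(θ√(1+t))/K_ν(θ)`. -/
theorem gig_generator_deriv
    (K : ℝ → ℝ → ℝ)
    (hK : ∀ ν t : ℝ, K ν t =
      ∫ x in Set.Ioi (0 : ℝ), Real.cosh (ν * x) * Real.exp (-t * Real.cosh x))
    (ν θ : ℝ) (hθ : 0 < θ)
    (ψ : ℝ → ℝ)
    (hψ : ∀ t : ℝ, ψ t =
      (1 + t) ^ (-ν / 2) * K ν (θ * Real.sqrt (1 + t)) / K ν θ) :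
    ∀ (d : ℕ) (t : ℝ), 0 < t →
      (-1 : ℝ) ^ d * iteratedDeriv d ψ t =
        (θ / 2) ^ d * (1 + t) ^ (-((ν + (d : ℝ)) / 2)) *
          K (ν + (d : ℝ)) (θ * Real.sqrt (1 + t)) / K ν θ := by
  have hKb : K = besselK := funext₂ hK
  have hψb : ψ = fun s => (1 + s) ^ (-(ν / 2)) * besselK ν (θ * Real.sqrt (1 + s)) / besselK ν θ :=
    funext fun s => by rw [hψ, hKb, neg_div]
  intro d t ht
  rw [hψb, iteratedDeriv_rpow_mul_besselK ν hθ _ d (by linarith), hKb, neg_pow (θ / 2)]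
  have hsign : (-1 : ℝ) ^ d * (-1) ^ d = 1 := by rw [← mul_pow]; simp
  linear_combination (θ / 2) ^ d * ((1 + t) ^ (-((ν + d) / 2)) *
    besselK (ν + d) (θ * Real.sqrt (1 + t))) / besselK ν θ * hsign
end

section
/- For ν ∈ ℝ and t > 0 let K_ν(t) = ∫_0^∞ cosh(ν·x)·exp(-t·cosh(x)) dx. Then for every ν > 0 and every t ≥ 0, the limit as θ → 0⁺ of (1+t)^{-ν/2}·K_ν(θ·√(1+t))/K_ν(θ) equals (1+t)^{-ν}; that is, as θ → 0⁺ the GIG generator with parameters (ν,θ) converges pointwise to the Clayton generator with parameter 1/ν. -/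
/-- The integrand of `K_ν(t)`, translated by `log t` and multiplied by `t ^ ν`. -/
theorem rpow_mul_cosh_sub_log_mul_exp (ν y : ℝ) {t : ℝ} (ht : 0 < t) :
    t ^ ν * (Real.cosh (ν * (y - Real.log t)) * Real.exp (-t * Real.cosh (y - Real.log t))) =
      (Real.exp (ν * y) + t ^ (2 * ν) * Real.exp (-(ν * y))) / 2 *
        Real.exp (-(Real.exp y + t ^ 2 * Real.exp (-y)) / 2) := by
  have h₁ : t * Real.cosh (y - Real.log t) = (Real.exp y + t ^ 2 * Real.exp (-y)) / 2 := by
    rw [Real.cosh_eq, neg_sub, Real.exp_sub, Real.exp_sub, Real.exp_log ht, Real.exp_neg]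
    field_simp
  have h₂ : t ^ ν * Real.cosh (ν * (y - Real.log t)) =
      (Real.exp (ν * y) + t ^ (2 * ν) * Real.exp (-(ν * y))) / 2 := by
    rw [Real.cosh_eq, Real.rpow_def_of_pos ht, Real.rpow_def_of_pos ht, mul_div_assoc', mul_add,
      ← Real.exp_add, ← Real.exp_add, ← Real.exp_add]
    ring_nf
  rw [← mul_assoc, h₂, neg_mul, h₁, neg_div]

theorem integrable_exp_mul_sub_exp_div_two {ν : ℝ} (hν : 0 < ν) :
    MeasureTheory.Integrable (fun y : ℝ => Real.exp (ν * y - Real.exp y / 2)) := by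
  have hg : MeasureTheory.IntegrableOn
      (fun u : ℝ => u ^ (ν - 1) * Real.exp (-(1 / 2) * u)) (Set.Ioi 0) := by
    simpa using integrableOn_rpow_mul_exp_neg_mul_rpow (p := 1) (s := ν - 1) (b := 1 / 2)
      (by linarith) one_pos (by norm_num)
  have himg : Real.exp '' Set.univ = Set.Ioi 0 := by rw [Set.image_univ, Real.range_exp]
  rw [← himg, MeasureTheory.integrableOn_image_iff_integrableOn_abs_deriv_smul MeasurableSet.univ
    (fun x _ => (Real.hasDerivAt_exp x).hasDerivWithinAt) Real.exp_injective.injOn,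
    MeasureTheory.integrableOn_univ] at hg
  refine hg.congr (Filter.Eventually.of_forall fun y => ?_)
  simp only [smul_eq_mul, Real.abs_exp]
  rw [← Real.exp_mul, ← Real.exp_add, ← Real.exp_add]
  ring_nf

theorem tendsto_rpow_mul_integral_cosh_mul_exp {ν : ℝ} (hν : 0 < ν) :
    Filter.Tendsto
      (fun t : ℝ => t ^ ν *
        ∫ x in Set.Ioi (0 : ℝ), Real.cosh (ν * x) * Real.exp (-t * Real.cosh x))
      (nhdsWithin 0 (Set.Ioi 0))
      (nhds (∫ y : ℝ, Real.exp (ν * y - Real.exp y / 2) / 2)) := by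
  let h : ℝ → ℝ → ℝ := fun t x => Real.cosh (ν * x) * Real.exp (-t * Real.cosh x)
  have hshift : ∀ t : ℝ, t ^ ν * ∫ x in Set.Ioi (0 : ℝ), h t x =
      ∫ y : ℝ, t ^ ν * (Set.Ioi (0 : ℝ)).indicator (h t) (y - Real.log t) := fun t => by
    rw [MeasureTheory.integral_const_mul,
      MeasureTheory.integral_sub_right_eq_self ((Set.Ioi (0 : ℝ)).indicator (h t)),
      MeasureTheory.integral_indicator measurableSet_Ioi]
  change Filter.Tendsto (fun t : ℝ => t ^ ν * ∫ x in Set.Ioi (0 : ℝ), h t x) _ _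
  simp_rw [hshift]
  refine MeasureTheory.tendsto_integral_filter_of_dominated_convergence
    (fun y => Real.exp (ν * y - Real.exp y / 2)) ?_ ?_
    (integrable_exp_mul_sub_exp_div_two hν) ?_
  · refine Filter.Eventually.of_forall fun t => Measurable.aestronglyMeasurable ?_
    have hm : Measurable (h t) := by fun_prop
    exact ((hm.indicator measurableSet_Ioi).comp (measurable_id.sub_const _)).const_mul _
  · filter_upwards [self_mem_nhdsWithin] with t (ht : 0 < t)
    refine Filter.Eventually.of_forall fun y => ?_
    by_cases hy : y - Real.log t ∈ Set.Ioi (0 : ℝ)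
    · rw [Set.indicator_of_mem hy, rpow_mul_cosh_sub_log_mul_exp ν y ht,
        Real.norm_of_nonneg (by positivity), sub_eq_add_neg (ν * y), Real.exp_add]
      have hy' : 0 < y - Real.log t := hy
      have hle : t ^ (2 * ν) * Real.exp (-(ν * y)) ≤ Real.exp (ν * y) := by
        rw [Real.rpow_def_of_pos ht, ← Real.exp_add, Real.exp_le_exp]
        nlinarith
      gcongr
      · linarith
      · have : 0 ≤ t ^ 2 * Real.exp (-y) := by positivity
        linarith
    · rw [Set.indicator_of_notMem hy, mul_zero, norm_zero]
      positivity
  · refine Filter.Eventually.of_forall fun y => ?_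
    have hlim : Filter.Tendsto
        (fun t : ℝ => (Real.exp (ν * y) + t ^ (2 * ν) * Real.exp (-(ν * y))) / 2 *
          Real.exp (-(Real.exp y + t ^ 2 * Real.exp (-y)) / 2))
        (nhdsWithin 0 (Set.Ioi 0)) (nhds (Real.exp (ν * y - Real.exp y / 2) / 2)) := by
      have hc : Continuous fun t : ℝ =>
          (Real.exp (ν * y) + t ^ (2 * ν) * Real.exp (-(ν * y))) / 2 *
            Real.exp (-(Real.exp y + t ^ 2 * Real.exp (-y)) / 2) := by
        have := Real.continuous_rpow_const (q := 2 * ν) (by positivity)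
        fun_prop
      convert (hc.tendsto 0).mono_left nhdsWithin_le_nhds using 2
      rw [Real.zero_rpow (by positivity), sub_eq_add_neg, Real.exp_add]
      ring_nf
    refine hlim.congr' ?_
    filter_upwards [self_mem_nhdsWithin,
      nhdsWithin_le_nhds (Iio_mem_nhds (Real.exp_pos y))] with t (ht : 0 < t) (hty : t < Real.exp y)
    rw [Set.indicator_of_mem, rpow_mul_cosh_sub_log_mul_exp ν y ht]
    exact sub_pos.2 ((Real.log_lt_iff_lt_exp ht).2 hty)


/-- Clayton limit of the GIG generator: with
`K_ν(t) = ∫_0^∞ cosh(νx) e^{-t cosh x} dx`, for every `ν > 0` and `t ≥ 0`,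
`(1+t)^{-ν/2} K_ν(θ√(1+t))/K_ν(θ) → (1+t)^{-ν}` as `θ → 0⁺`; that is, the GIG
generator with parameters `(ν,θ)` converges pointwise to the Clayton generator
with parameter `1/ν`. -/
theorem gig_generator_clayton_limit
    (K : ℝ → ℝ → ℝ)
    (hK : ∀ ν t : ℝ, K ν t =
      ∫ x in Set.Ioi (0 : ℝ), Real.cosh (ν * x) * Real.exp (-t * Real.cosh x)) :
    ∀ ν : ℝ, 0 < ν → ∀ t : ℝ, 0 ≤ t →
      Filter.Tendsto
        (fun θ : ℝ => (1 + t) ^ (-ν / 2) * K ν (θ * Real.sqrt (1 + t)) / K ν θ)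
        (nhdsWithin 0 (Set.Ioi (0 : ℝ)))
        (nhds ((1 + t) ^ (-ν))) := by
  intro ν hν t ht
  have hF : Filter.Tendsto (fun θ : ℝ => θ ^ ν * K ν θ) (nhdsWithin 0 (Set.Ioi 0))
      (nhds (∫ y : ℝ, Real.exp (ν * y - Real.exp y / 2) / 2)) := by
    simpa only [hK] using tendsto_rpow_mul_integral_cosh_mul_exp hν
  have hc : (∫ y : ℝ, Real.exp (ν * y - Real.exp y / 2) / 2) ≠ 0 := by
    rw [MeasureTheory.integral_div]
    have := MeasureTheory.integral_exp_pos (integrable_exp_mul_sub_exp_div_two hν)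
    positivity
  have h1t : 0 < 1 + t := by linarith
  have hs : 0 < Real.sqrt (1 + t) := Real.sqrt_pos.2 h1t
  have hscale : Filter.Tendsto (fun θ : ℝ => θ * Real.sqrt (1 + t))
      (nhdsWithin 0 (Set.Ioi 0)) (nhdsWithin 0 (Set.Ioi 0)) := by
    refine tendsto_nhdsWithin_iff.2 ⟨?_, ?_⟩
    · have : Continuous fun θ : ℝ => θ * Real.sqrt (1 + t) := by fun_prop
      simpa using (this.tendsto 0).mono_left nhdsWithin_le_nhds
    · filter_upwards [self_mem_nhdsWithin] with θ hθ using mul_pos hθ hs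
  have hlim := ((hF.comp hscale).div hF hc).const_mul ((1 + t) ^ (-ν))
  rw [div_self hc, mul_one] at hlim
  refine hlim.congr' ?_
  filter_upwards [self_mem_nhdsWithin] with θ (hθ : 0 < θ)
  have hpow : (1 + t) ^ (-ν) * Real.sqrt (1 + t) ^ ν = (1 + t) ^ (-ν / 2) := by
    rw [Real.sqrt_eq_rpow, ← Real.rpow_mul h1t.le, ← Real.rpow_add h1t]
    ring_nf
  have hθν : θ ^ ν ≠ 0 := (Real.rpow_pos_of_pos hθ ν).ne'
  simp only [Function.comp_apply, Pi.div_apply]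
  rw [Real.mul_rpow hθ.le hs.le, ← hpow, mul_assoc (θ ^ ν), mul_div_mul_left _ _ hθν]
  ring
end
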